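/- arXiv:1207.0715 — 3 statements merged into one kernel-verified Lean document; each statement's English description precedes it below -/
import Mathlib

section
/- Let n ≥ 3 and let E ⊂ ℝⁿ be a measurable set with |E| = |B_1|. Then NL(B_1) − NL(E) ≤ 2 ∫_{B_1} v(y) dy, where v(y) = ∫_{ℝⁿ} (χ_{B_1} − χ_E)(x) |x−y|^{2−n} dx. -/
open MeasureTheory Metric Set

noncomputable section

/-- The divergence of a vector field on `ℝⁿ`. -/
def vdiv {n : ℕ} (φ : EuclideanSpace ℝ (Fin n) → EuclideanSpace ℝ (Fin n))
    (x : EuclideanSpace ℝ (Fin n)) : ℝ :=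
  ∑ i, fderiv ℝ φ x (EuclideanSpace.single i 1) i

/-- The set of admissible values `∫_F div φ` in the variational definition of the
perimeter: `φ` ranges over compactly supported `C¹` vector fields with `‖φ‖ ≤ 1`. -/
def perimVals {n : ℕ} (F : Set (EuclideanSpace ℝ (Fin n))) : Set ℝ :=
  { r | ∃ φ : EuclideanSpace ℝ (Fin n) → EuclideanSpace ℝ (Fin n),
      ContDiff ℝ 1 φ ∧ HasCompactSupport φ ∧ (∀ x, ‖φ x‖ ≤ 1) ∧
      r = ∫ x in F, vdiv φ x }

/-- The (distributional) perimeter `P(F)`. -/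
def perimeter {n : ℕ} (F : Set (EuclideanSpace ℝ (Fin n))) : ℝ := sSup (perimVals F)

/-- `F` is a set of finite perimeter: it is measurable and the variational
definition of the perimeter is finite. -/
def HasFinitePerimeter {n : ℕ} (F : Set (EuclideanSpace ℝ (Fin n))) : Prop :=
  MeasurableSet F ∧ BddAbove (perimVals F)

/-- The Newtonian interaction energy `NL(F) = ∫∫ χ_F(x)χ_F(y)|x-y|^{2-n}`. -/
def NL {n : ℕ} (F : Set (EuclideanSpace ℝ (Fin n))) : ℝ :=
  ∫ x in F, ∫ y in F, ‖x - y‖ ^ (2 - (n : ℝ))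

/-- The function `f_E = χ_{B_1} - χ_E`. -/
def fE {n : ℕ} (E : Set (EuclideanSpace ℝ (Fin n))) (x : EuclideanSpace ℝ (Fin n)) : ℝ :=
  (ball (0 : EuclideanSpace ℝ (Fin n)) 1).indicator 1 x - E.indicator 1 x

/-- The Newtonian potential `v(y) = ∫ (χ_{B_1} - χ_E)(x) |x-y|^{2-n} dx`. -/
def newtPot {n : ℕ} (E : Set (EuclideanSpace ℝ (Fin n))) (y : EuclideanSpace ℝ (Fin n)) : ℝ :=
  ∫ x, fE E x * ‖x - y‖ ^ (2 - (n : ℝ))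

/-- The normalization constant `σ_{n,α}` of the Riesz potential. -/
def rieszConst (n : ℕ) (α : ℝ) : ℝ :=
  (Real.pi ^ ((n : ℝ) / 2) * 2 ^ α * Real.Gamma (α / 2) / Real.Gamma (((n : ℝ) - α) / 2))⁻¹

/-- The Riesz potential `I_α f(x) = σ_{n,α} ∫ f(ξ)|x-ξ|^{α-n} dξ`. -/
def rieszPot {n : ℕ} (α : ℝ) (f : EuclideanSpace ℝ (Fin n) → ℝ)
    (x : EuclideanSpace ℝ (Fin n)) : ℝ :=
  rieszConst n α * ∫ ξ, f ξ * ‖x - ξ‖ ^ (α - (n : ℝ))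

/-- The average of `g` over the sphere `∂B_r` with respect to the
`(n-1)`-dimensional Hausdorff measure. -/
def sphAvg {n : ℕ} (g : EuclideanSpace ℝ (Fin n) → ℝ) (r : ℝ) : ℝ :=
  (μH[(n : ℝ) - 1] (sphere (0 : EuclideanSpace ℝ (Fin n)) r)).toReal⁻¹ *
    ∫ y in sphere (0 : EuclideanSpace ℝ (Fin n)) r, g y ∂μH[(n : ℝ) - 1]

/-- The average of `g` over the ball `B_r` with respect to the Lebesgue measure. -/
def ballAvg {n : ℕ} (g : EuclideanSpace ℝ (Fin n) → ℝ) (r : ℝ) : ℝ :=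
  (volume (ball (0 : EuclideanSpace ℝ (Fin n)) r)).toReal⁻¹ *
    ∫ x in ball (0 : EuclideanSpace ℝ (Fin n)) r, g x

end


theorem pd_abstract {P X : Type*} [MeasurableSpace P] [MeasurableSpace X]
    (μ : Measure P) [SFinite μ] (ν : Measure X) [SFinite ν] (ρ : Measure X) [SFinite ρ]
    (φ : P → X → ENNReal) (hφ : Measurable (Function.uncurry φ)) :
    ∫⁻ x, ∫⁻ y, ∫⁻ p, φ p x * φ p y ∂μ ∂ρ ∂ν =
      ∫⁻ p, (∫⁻ x, φ p x ∂ν) * (∫⁻ y, φ p y ∂ρ) ∂μ := by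
  have hφ1 : ∀ p, Measurable (φ p) := fun p => hφ.comp measurable_prodMk_left
  have hφ2 : ∀ x, Measurable (fun p => φ p x) := fun p => hφ.comp measurable_prodMk_right
  have hI : Measurable (fun p => ∫⁻ y, φ p y ∂ρ) := Measurable.lintegral_prod_right hφ
  calc ∫⁻ x, ∫⁻ y, ∫⁻ p, φ p x * φ p y ∂μ ∂ρ ∂ν
      = ∫⁻ x, ∫⁻ p, φ p x * (∫⁻ y, φ p y ∂ρ) ∂μ ∂ν := by
        refine lintegral_congr fun x => ?_
        rw [lintegral_lintegral_swap]
        · refine lintegral_congr fun p => ?_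
          rw [lintegral_const_mul _ (hφ1 p)]
        · refine Measurable.aemeasurable ?_
          exact ((hφ2 x).comp measurable_snd).mul (hφ.comp measurable_swap)
    _ = ∫⁻ p, ∫⁻ x, φ p x * (∫⁻ y, φ p y ∂ρ) ∂ν ∂μ := by
        rw [lintegral_lintegral_swap]
        refine Measurable.aemeasurable ?_
        exact (hφ.comp measurable_swap).mul (hI.comp measurable_snd)
    _ = _ := by
        refine lintegral_congr fun p => ?_
        rw [lintegral_mul_const _ (hφ1 p)]

theorem two_mul_le_ennreal (a b : ENNReal) : 2 * (a * b) ≤ a * a + b * b := by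
  rcases eq_or_ne a ⊤ with rfl | ha
  · simp
  rcases eq_or_ne b ⊤ with rfl | hb
  · simp
  lift a to NNReal using ha
  lift b to NNReal using hb
  norm_cast
  rw [← NNReal.coe_le_coe]
  push_cast
  nlinarith [sq_nonneg ((a : ℝ) - b)]

/-- ENNReal kernel -/
noncomputable def kk {n : ℕ} (x y : EuclideanSpace ℝ (Fin n)) : ENNReal :=
  ENNReal.ofReal (‖x - y‖ ^ (2 - (n : ℝ)))

noncomputable def phi {n : ℕ} (p : ℝ × EuclideanSpace ℝ (Fin n)) (x : EuclideanSpace ℝ (Fin n)) : ENNReal :=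
  ENNReal.ofReal (p.1 ^ (((n : ℝ) - 2) / 2) * Real.exp (-(2 * p.1) * ‖x - p.2‖ ^ 2))

theorem phi_meas {n : ℕ} : Measurable (Function.uncurry (phi (n := n))) := by
  unfold phi Function.uncurry
  fun_prop

theorem kk_meas {n : ℕ} : Measurable (Function.uncurry (kk (n := n))) := by
  unfold kk Function.uncurry
  fun_prop

theorem gauss_lint {n : ℕ} {t : ℝ} (ht : 0 < t) (x y : EuclideanSpace ℝ (Fin n)) :
    ∫⁻ z, phi (t, z) x * phi (t, z) y =
      ENNReal.ofReal ((Real.pi / 4) ^ ((n : ℝ) / 2) *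
        (t ^ (((n : ℝ) / 2 - 1) - 1) * Real.exp (-(‖x - y‖ ^ 2 * t)))) := by
  have key : ∀ z, phi (t, z) x * phi (t, z) y =
      ENNReal.ofReal (t ^ ((n : ℝ) - 2) * Real.exp (-(‖x - y‖ ^ 2 * t))) *
        ENNReal.ofReal (Real.exp (-(4 * t) * ‖z - (2⁻¹ : ℝ) • (x + y)‖ ^ 2)) := by
    intro z
    unfold phi
    rw [← ENNReal.ofReal_mul (by positivity), ← ENNReal.ofReal_mul (by positivity)]
    congr 1
    have h1 := parallelogram_law_with_norm ℝ (x - z) (y - z)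
    have h2 : (x - z) + (y - z) = (-2 : ℝ) • (z - (2⁻¹ : ℝ) • (x + y)) := by
      module
    have h3 : (x - z) - (y - z) = x - y := by abel
    rw [h2, h3, norm_smul] at h1
    norm_num at h1
    rw [show (n : ℝ) - 2 = ((n : ℝ) - 2) / 2 + ((n : ℝ) - 2) / 2 by ring, Real.rpow_add ht]
    have : Real.exp (-(2 * t) * ‖x - z‖ ^ 2) * Real.exp (-(2 * t) * ‖y - z‖ ^ 2) =
      Real.exp (-(‖x - y‖ ^ 2 * t)) * Real.exp (-(4 * t) * ‖z - (2⁻¹ : ℝ) • (x + y)‖ ^ 2) := by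
      rw [← Real.exp_add, ← Real.exp_add]
      congr 1
      norm_num
      linear_combination (t) * h1
    ring_nf at this ⊢
    linear_combination ((t ^ (-1 + (n : ℝ) * (1 / 2))) ^ 2) * this
  simp_rw [key]
  rw [lintegral_const_mul _ (by fun_prop)]
  rw [lintegral_sub_right_eq_self (fun z : EuclideanSpace ℝ (Fin n) =>
    ENNReal.ofReal (Real.exp (-(4 * t) * ‖z‖ ^ 2)))]
  have hG := GaussianFourier.integral_rexp_neg_mul_sq_norm
    (V := EuclideanSpace ℝ (Fin n)) (b := 4 * t) (by positivity)
  have hint : Integrable (fun z : EuclideanSpace ℝ (Fin n) =>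
      Real.exp (-(4 * t) * ‖z‖ ^ 2)) :=
    .of_integral_ne_zero (by rw [hG]; positivity)
  rw [← ofReal_integral_eq_lintegral_ofReal hint (ae_of_all _ fun _ => by positivity), hG,
    ← ENNReal.ofReal_mul (by positivity)]
  congr 1
  rw [finrank_euclideanSpace_fin, show Real.pi / (4 * t) = (Real.pi / 4) * t⁻¹ by field_simp,
    Real.mul_rpow (by positivity) (by positivity), Real.inv_rpow ht.le, ← Real.rpow_neg ht.le]
  have : t ^ ((n : ℝ) - 2) * t ^ (-((n : ℝ) / 2)) = t ^ (((n : ℝ) / 2 - 1) - 1) := by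
    rw [← Real.rpow_add ht]; congr 1; ring
  rw [← this]; ring

theorem phi_lint {n : ℕ} (hn : 3 ≤ n) {x y : EuclideanSpace ℝ (Fin n)} (hxy : x ≠ y) :
    ∫⁻ p, phi p x * phi p y ∂((volume.restrict (Ioi (0 : ℝ))).prod volume) =
      ENNReal.ofReal ((Real.pi / 4) ^ ((n : ℝ) / 2) * Real.Gamma ((n : ℝ) / 2 - 1)) * kk x y := by
  have hn' : (3 : ℝ) ≤ n := by exact_mod_cast hn
  have hr : 0 < ‖x - y‖ := norm_pos_iff.mpr (sub_ne_zero.mpr hxy)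
  have hp : ∀ x : EuclideanSpace ℝ (Fin n), Measurable (fun p => phi p x) :=
    fun x => phi_meas.comp measurable_prodMk_right
  have hpp : Measurable (fun p => phi p x * phi p y) := (hp x).mul (hp y)
  rw [lintegral_prod _ hpp.aemeasurable]
  rw [setLIntegral_congr_fun measurableSet_Ioi (fun t ht => gauss_lint ht x y)]
  have hI := Real.integral_rpow_mul_exp_neg_mul_Ioi (a := (n : ℝ) / 2 - 1) (r := ‖x - y‖ ^ 2)
    (by linarith) (by positivity)
  have hGpos : 0 < Real.Gamma ((n : ℝ) / 2 - 1) := Real.Gamma_pos_of_pos (by linarith)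
  have hint : IntegrableOn (fun t : ℝ => t ^ (((n : ℝ) / 2 - 1) - 1) *
      Real.exp (-(‖x - y‖ ^ 2 * t))) (Ioi 0) :=
    .of_integral_ne_zero (by rw [hI]; positivity)
  rw [← ofReal_integral_eq_lintegral_ofReal (hint.const_mul _), integral_const_mul, hI, kk,
    ← ENNReal.ofReal_mul (by positivity)]
  · congr 1
    have : (1 / ‖x - y‖ ^ 2) ^ ((n : ℝ) / 2 - 1) = ‖x - y‖ ^ (2 - (n : ℝ)) := by
      rw [one_div, Real.inv_rpow (by positivity), ← Real.rpow_neg (by positivity),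
        ← Real.rpow_natCast, ← Real.rpow_mul hr.le]
      congr 1; push_cast; ring
    rw [this]; ring
  · filter_upwards [ae_restrict_mem measurableSet_Ioi] with t ht
    have : (0 : ℝ) < t := ht
    positivity

theorem kk_rep {n : ℕ} (hn : 3 ≤ n) (S T : Set (EuclideanSpace ℝ (Fin n))) :
    ENNReal.ofReal ((Real.pi / 4) ^ ((n : ℝ) / 2) * Real.Gamma ((n : ℝ) / 2 - 1)) *
      ∫⁻ x in S, ∫⁻ y in T, kk x y =
        ∫⁻ p, (∫⁻ x in S, phi p x) * (∫⁻ y in T, phi p y)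
          ∂((volume.restrict (Ioi (0 : ℝ))).prod volume) := by
  have : Nontrivial (EuclideanSpace ℝ (Fin n)) := by
    have : Nonempty (Fin n) := ⟨⟨0, by omega⟩⟩
    infer_instance
  have hk1 : ∀ x : EuclideanSpace ℝ (Fin n), Measurable (kk x) := by
    intro x
    unfold kk
    fun_prop
  rw [← pd_abstract _ (volume.restrict S) (volume.restrict T) phi phi_meas,
    ← lintegral_const_mul' _ _ ENNReal.ofReal_ne_top]
  refine lintegral_congr fun x => ?_
  rw [← lintegral_const_mul _ (hk1 x)]
  refine lintegral_congr_ae ?_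
  have h : ∀ᵐ y ∂(volume.restrict T), y ≠ x := by
    refine ae_restrict_of_ae ?_
    exact Measure.ae_ne volume x
  filter_upwards [h] with y hy
  rw [phi_lint hn hy.symm]

theorem kk_pd {n : ℕ} (hn : 3 ≤ n) (A B : Set (EuclideanSpace ℝ (Fin n))) :
    2 * ∫⁻ x in A, ∫⁻ y in B, kk x y ≤
      (∫⁻ x in A, ∫⁻ y in A, kk x y) + ∫⁻ x in B, ∫⁻ y in B, kk x y := by
  have hn' : (3 : ℝ) ≤ n := by exact_mod_cast hn
  have hGpos : 0 < Real.Gamma ((n : ℝ) / 2 - 1) := Real.Gamma_pos_of_pos (by linarith)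
  have rep := kk_rep hn
  have hC0 : ENNReal.ofReal ((Real.pi / 4) ^ ((n : ℝ) / 2) * Real.Gamma ((n : ℝ) / 2 - 1)) ≠ 0 :=
    (ENNReal.ofReal_pos.mpr (by positivity)).ne'
  have hCt : ENNReal.ofReal ((Real.pi / 4) ^ ((n : ℝ) / 2) * Real.Gamma ((n : ℝ) / 2 - 1)) ≠ ⊤ :=
    ENNReal.ofReal_ne_top
  generalize ENNReal.ofReal ((Real.pi / 4) ^ ((n : ℝ) / 2) * Real.Gamma ((n : ℝ) / 2 - 1)) = C
    at rep hC0 hCt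
  have hm : ∀ S : Set (EuclideanSpace ℝ (Fin n)),
      Measurable (fun p => ∫⁻ x in S, phi p x) := fun S =>
    Measurable.lintegral_prod_right phi_meas
  have hmm : Measurable (fun p => (∫⁻ x in A, phi p x) * ∫⁻ x in A, phi p x) :=
    (hm A).mul (hm A)
  rw [← ENNReal.mul_le_mul_iff_right hC0 hCt, mul_add, rep A A, rep B B, mul_left_comm, rep A B,
    ← lintegral_const_mul' _ _ (by simp), ← lintegral_add_left hmm]
  exact lintegral_mono fun p => two_mul_le_ennreal _ _

theorem pot_bdd {n : ℕ} (hn : 3 ≤ n) (S : Set (EuclideanSpace ℝ (Fin n))) (hS : volume S ≠ ⊤) :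
    ∃ C : ENNReal, C ≠ ⊤ ∧ ∀ x, ∫⁻ y in S, kk x y ≤ C := by
  have hn' : (3 : ℝ) ≤ n := by exact_mod_cast hn
  have : Nontrivial (EuclideanSpace ℝ (Fin n)) := by
    have : Nonempty (Fin n) := ⟨⟨0, by omega⟩⟩
    infer_instance
  have hI : IntegrableOn (fun x : EuclideanSpace ℝ (Fin n) => ‖x‖ ^ (2 - (n : ℝ)))
      (ball 0 1) := by
    rw [integrableOn_fun_norm_addHaar volume (f := fun r : ℝ => r ^ (2 - (n : ℝ)))]
    have h1 : IntegrableOn (fun x : ℝ => x ^ (1 : ℝ)) (Ioo 0 1) :=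
      (intervalIntegral.integrableOn_Ioo_rpow_iff one_pos).mpr (by norm_num)
    refine h1.congr_fun (fun t ht => ?_) measurableSet_Ioo
    have ht0 : 0 < t := ht.1
    simp only [finrank_euclideanSpace_fin, smul_eq_mul]
    rw [← Real.rpow_natCast, ← Real.rpow_add ht0, Nat.cast_sub (by omega)]
    congr 1; push_cast; ring
  refine ⟨(∫⁻ z in ball (0 : EuclideanSpace ℝ (Fin n)) 1,
    ENNReal.ofReal (‖z‖ ^ (2 - (n : ℝ)))) + volume S, ?_, fun x => ?_⟩
  · exact ENNReal.add_ne_top.mpr ⟨hI.lintegral_lt_top.ne, hS⟩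
  · set g : EuclideanSpace ℝ (Fin n) → ENNReal :=
      (ball (0 : EuclideanSpace ℝ (Fin n)) 1).indicator
        (fun z => ENNReal.ofReal (‖z‖ ^ (2 - (n : ℝ)))) with hg
    have hgm : Measurable g := Measurable.indicator (by fun_prop) measurableSet_ball
    calc ∫⁻ y in S, kk x y ≤ ∫⁻ y in S, (g (x - y) + 1) := by
          refine lintegral_mono fun y => ?_
          by_cases h : x - y ∈ ball (0 : EuclideanSpace ℝ (Fin n)) 1
          · rw [hg, indicator_of_mem h]; exact le_self_add
          · have h1 : 1 ≤ ‖x - y‖ := by simpa using h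
            refine le_trans ?_ le_add_self
            unfold kk
            rw [← ENNReal.ofReal_one]
            exact ENNReal.ofReal_le_ofReal
              (Real.rpow_le_one_of_one_le_of_nonpos h1 (by linarith))
      _ = (∫⁻ y in S, g (x - y)) + volume S := by
          rw [lintegral_add_right _ measurable_const]; simp
      _ ≤ (∫⁻ y, g (x - y)) + volume S := by gcongr; exact Measure.restrict_le_self
      _ = _ := by
          rw [lintegral_sub_left_eq_self g x, hg, lintegral_indicator measurableSet_ball]

theorem kk_symm {n : ℕ} (x y : EuclideanSpace ℝ (Fin n)) : kk x y = kk y x := by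
  unfold kk; rw [norm_sub_rev]

theorem pot_real {n : ℕ} (S : Set (EuclideanSpace ℝ (Fin n))) (x : EuclideanSpace ℝ (Fin n)) :
    ∫ y in S, ‖x - y‖ ^ (2 - (n : ℝ)) = (∫⁻ y in S, kk x y).toReal := by
  rw [integral_eq_lintegral_of_nonneg_ae]
  · rfl
  · exact ae_of_all _ fun y => by positivity
  · exact Measurable.aestronglyMeasurable (by fun_prop)

theorem pot_meas {n : ℕ} (S : Set (EuclideanSpace ℝ (Fin n))) :
    Measurable (fun x => ∫⁻ y in S, kk x y) :=
  Measurable.lintegral_prod_right kk_meas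

/-- `NL(B_1) - NL(E) ≤ 2 ∫_{B_1} v(y) dy` where `v` is the Newtonian potential of
`χ_{B_1} - χ_E`. -/
theorem statement5 (n : ℕ) (hn : 3 ≤ n) (E : Set (EuclideanSpace ℝ (Fin n)))
    (hE : MeasurableSet E)
    (hvol : volume E = volume (ball (0 : EuclideanSpace ℝ (Fin n)) 1)) :
    NL (ball (0 : EuclideanSpace ℝ (Fin n)) 1) - NL E ≤
      2 * ∫ y in ball (0 : EuclideanSpace ℝ (Fin n)) 1, newtPot E y := by
  have hB : volume (ball (0 : EuclideanSpace ℝ (Fin n)) 1) ≠ ⊤ := measure_ball_lt_top.ne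
  have hEf : volume E ≠ ⊤ := hvol ▸ hB
  set B := ball (0 : EuclideanSpace ℝ (Fin n)) 1 with hBdef
  have hpt : ∀ S : Set (EuclideanSpace ℝ (Fin n)), volume S ≠ ⊤ → ∀ x,
      ∫⁻ y in S, kk x y ≠ ⊤ := by
    intro S hS x
    obtain ⟨C, hC, h⟩ := pot_bdd hn S hS
    exact ne_top_of_le_ne_top hC (h x)
  have hD : ∀ S T : Set (EuclideanSpace ℝ (Fin n)), volume S ≠ ⊤ → volume T ≠ ⊤ →
      ∫⁻ x in S, ∫⁻ y in T, kk x y ≠ ⊤ := by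
    intro S T hS hT
    obtain ⟨C, hC, h⟩ := pot_bdd hn T hT
    refine ne_top_of_le_ne_top ?_ (lintegral_mono fun x => h x)
    simpa using ENNReal.mul_ne_top hC hS
  have hDr : ∀ S T : Set (EuclideanSpace ℝ (Fin n)), volume T ≠ ⊤ →
      ∫ x in S, (∫⁻ y in T, kk x y).toReal = (∫⁻ x in S, ∫⁻ y in T, kk x y).toReal := by
    intro S T hT
    exact integral_toReal (pot_meas T).aemeasurable
      (ae_of_all _ fun x => (hpt T hT x).lt_top)
  have hDi : ∀ S T : Set (EuclideanSpace ℝ (Fin n)), volume S ≠ ⊤ → volume T ≠ ⊤ →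
      IntegrableOn (fun x => (∫⁻ y in T, kk x y).toReal) S := by
    intro S T hS hT
    exact integrable_toReal_of_lintegral_ne_top (pot_meas T).aemeasurable (hD S T hS hT)
  have hNL : ∀ S : Set (EuclideanSpace ℝ (Fin n)), volume S ≠ ⊤ →
      NL S = (∫⁻ x in S, ∫⁻ y in S, kk x y).toReal := by
    intro S hS
    unfold NL
    simp_rw [pot_real]
    exact hDr S S hS
  have hki : ∀ S : Set (EuclideanSpace ℝ (Fin n)), volume S ≠ ⊤ → ∀ x,
      IntegrableOn (fun y => ‖x - y‖ ^ (2 - (n : ℝ))) S := by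
    intro S hS x
    refine ⟨Measurable.aestronglyMeasurable (by fun_prop), ?_⟩
    rw [hasFiniteIntegral_iff_ofReal (ae_of_all _ fun y => by positivity)]
    exact (hpt S hS x).lt_top
  have hv : ∀ y, newtPot E y = (∫⁻ x in B, kk y x).toReal - (∫⁻ x in E, kk y x).toReal := by
    intro y
    rw [← pot_real, ← pot_real, ← integral_indicator measurableSet_ball, ← integral_indicator hE,
      ← integral_sub ((hki B hB y).integrable_indicator measurableSet_ball)
        ((hki E hEf y).integrable_indicator hE)]
    unfold newtPot fE
    refine integral_congr_ae (ae_of_all _ fun x => ?_)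
    simp only [indicator, norm_sub_rev x y, ← hBdef, Pi.one_apply]
    split_ifs <;> ring
  simp_rw [hv]
  rw [integral_sub (hDi B B hB hB) (hDi B E hB hEf), hDr B B hB, hDr B E hEf, hNL B hB, hNL E hEf]
  have h := ENNReal.toReal_mono (ENNReal.add_ne_top.mpr ⟨hD B B hB hB, hD E E hEf hEf⟩)
    (kk_pd hn B E)
  rw [ENNReal.toReal_add (hD B B hB hB) (hD E E hEf hEf), ENNReal.toReal_mul] at h
  norm_num at h
  linarith
end

section
/- Let E ⊂ ℝ³ be a set of finite perimeter with |E| = |B_1| such that the infimum defining γ(E) is attained at y = 0, i.e. γ(E) = ∫_{B_1} 2/|x| dx − ∫_E 2/|x| dx. Then NL(B_1) − NL(E) ≤ |B_1| · γ(E). -/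
open MeasureTheory Metric Set

/-- The asymmetry `γ(E) = inf_y ( ∫_{B_1(y)} (n-1)/|x-y| dx - ∫_E (n-1)/|x-y| dx )`. -/
noncomputable def gammaAsym {n : ℕ} (E : Set (EuclideanSpace ℝ (Fin n))) : ℝ :=
  ⨅ y : EuclideanSpace ℝ (Fin n),
    ((∫ x in ball y 1, ((n : ℝ) - 1) / ‖x - y‖) - ∫ x in E, ((n : ℝ) - 1) / ‖x - y‖)


theorem aux_psd {X Z : Type*} [MeasurableSpace X] [MeasurableSpace Z] (μ : Measure X) [SFinite μ]
    (ν : Measure Z) [SFinite ν] (h : X → Z → ENNReal) (hh : Measurable (Function.uncurry h))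
    (A B : Set X) :
    2 * (∫⁻ x in A, ∫⁻ y in B, ∫⁻ z, h x z * h y z ∂ν ∂μ ∂μ) ≤
     (∫⁻ x in A, ∫⁻ y in A, ∫⁻ z, h x z * h y z ∂ν ∂μ ∂μ) +
     (∫⁻ x in B, ∫⁻ y in B, ∫⁻ z, h x z * h y z ∂ν ∂μ ∂μ) := by
  have hm1 : ∀ x, Measurable (h x) := fun x => hh.comp measurable_prodMk_left
  have hm2 : ∀ z, Measurable (fun x => h x z) := fun z => hh.comp measurable_prodMk_right
  have hmG : ∀ A : Set X, Measurable (fun z => ∫⁻ x in A, h x z ∂μ) := by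
    intro A
    exact Measurable.lintegral_prod_right (hh.comp measurable_swap)
  have key : ∀ A B : Set X, (∫⁻ x in A, ∫⁻ y in B, ∫⁻ z, h x z * h y z ∂ν ∂μ ∂μ) =
      ∫⁻ z, (∫⁻ x in A, h x z ∂μ) * (∫⁻ x in B, h x z ∂μ) ∂ν := by
    intro A B
    have h1 : ∀ x, (∫⁻ y in B, ∫⁻ z, h x z * h y z ∂ν ∂μ) =
        ∫⁻ z, h x z * (∫⁻ y in B, h y z ∂μ) ∂ν := by
      intro x
      rw [lintegral_lintegral_swap]
      · congr 1; ext z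
        rw [lintegral_const_mul _ (hm2 z)]
      · exact (Measurable.mul ((hm1 x).comp measurable_snd) hh).aemeasurable
    simp_rw [h1]
    rw [lintegral_lintegral_swap]
    · congr 1; ext z
      rw [lintegral_mul_const _ (hm2 z)]
    · exact (Measurable.mul hh ((hmG B).comp measurable_snd)).aemeasurable
  have hms : ∀ A B : Set X, Measurable (fun z => (∫⁻ x in A, h x z ∂μ) * (∫⁻ x in B, h x z ∂μ)) :=
    fun A B => (hmG A).mul (hmG B)
  rw [key, key, key, ← lintegral_add_left (hms A A), ← lintegral_const_mul _ (hms A B)]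
  apply lintegral_mono
  intro z
  simp only
  generalize (∫⁻ x in A, h x z ∂μ) = a
  generalize (∫⁻ x in B, h x z ∂μ) = b
  rcases eq_or_ne a ⊤ with rfl | ha
  · simp
  rcases eq_or_ne b ⊤ with rfl | hb
  · simp
  lift a to NNReal using ha
  lift b to NNReal using hb
  norm_cast
  rw [← NNReal.coe_le_coe]
  push_cast
  nlinarith [sq_nonneg ((a:ℝ) - b)]

noncomputable def auxH (x : EuclideanSpace ℝ (Fin 3)) (p : ℝ × EuclideanSpace ℝ (Fin 3)) : ENNReal :=
  ENNReal.ofReal (√((Real.pi / (4 * p.1 ^ 2)) ^ (3 / 2 : ℝ))⁻¹ * Real.exp (-(2 * p.1 ^ 2) * ‖x - p.2‖ ^ 2))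

theorem auxH_meas : Measurable (Function.uncurry auxH) := by
  unfold auxH Function.uncurry
  fun_prop

theorem auxH_ker (x y : EuclideanSpace ℝ (Fin 3)) (hxy : x ≠ y) :
    ∫⁻ p, auxH x p * auxH y p ∂((volume.restrict (Ioi (0:ℝ))).prod volume) =
      ENNReal.ofReal (√Real.pi / 2) * ENNReal.ofReal (‖x - y‖⁻¹) := by
  have hm : ∀ x, Measurable (auxH x) := by
    intro x; unfold auxH; fun_prop
  have hm2 : Measurable (fun p => auxH x p * auxH y p) := (hm x).mul (hm y)
  rw [lintegral_prod _ hm2.aemeasurable]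
  have h1 : ∀ u ∈ Ioi (0:ℝ), ∫⁻ z, auxH x (u, z) * auxH y (u, z) =
      ENNReal.ofReal (Real.exp (-(‖x - y‖ ^ 2) * u ^ 2)) := by
    intro u hu
    have hu : 0 < u := hu
    set c := (Real.pi / (4 * u ^ 2)) ^ (3 / 2 : ℝ) with hc
    have hcpos : 0 < c := by positivity
    have h2 : ∀ z, auxH x (u, z) * auxH y (u, z) =
        ENNReal.ofReal (c⁻¹ * Real.exp (-(‖x - y‖ ^ 2) * u ^ 2)) *
          ENNReal.ofReal (Real.exp (-(4 * u ^ 2) * ‖z - (1/2 : ℝ) • (x + y)‖ ^ 2)) := by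
      intro z
      unfold auxH
      simp only
      rw [← hc, ← ENNReal.ofReal_mul (by positivity), ← ENNReal.ofReal_mul (by positivity)]
      congr 1
      rw [mul_mul_mul_comm, Real.mul_self_sqrt (by positivity), mul_assoc, ← Real.exp_add, ← Real.exp_add]
      congr 2
      have := parallelogram_law_with_norm ℝ (x - z) (y - z)
      have e1 : x - z + (y - z) = (-2 : ℝ) • (z - (1/2 : ℝ) • (x + y)) := by
        module
      have e2 : x - z - (y - z) = x - y := by abel
      rw [e1, e2, norm_smul] at this
      generalize (1/2 : ℝ) • (x + y) = m at this ⊢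
      norm_num at this
      linear_combination (u^2) * this
    simp_rw [h2]
    rw [lintegral_const_mul _ (by fun_prop)]
    rw [lintegral_sub_right_eq_self (fun z => ENNReal.ofReal (Real.exp (-(4 * u ^ 2) * ‖z‖ ^ 2)))]
    have h3 := GaussianFourier.integral_rexp_neg_mul_sq_norm (V := EuclideanSpace ℝ (Fin 3)) (b := 4 * u ^ 2) (by positivity)
    simp only [finrank_euclideanSpace, Fintype.card_fin, Nat.cast_ofNat] at h3
    rw [← hc] at h3
    rw [← ofReal_integral_eq_lintegral_ofReal, h3, ← ENNReal.ofReal_mul (by positivity)]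
    · congr 1; field_simp
    · by_contra hcon
      rw [integral_undef hcon] at h3
      exact hcpos.ne h3
    · exact Filter.Eventually.of_forall fun _ => (Real.exp_pos _).le
  rw [setLIntegral_congr_fun measurableSet_Ioi h1]
  have hpos : 0 < ‖x - y‖ := norm_pos_iff.2 (sub_ne_zero.2 hxy)
  rw [← ofReal_integral_eq_lintegral_ofReal, integral_gaussian_Ioi, ← ENNReal.ofReal_mul (by positivity)]
  · congr 1
    rw [Real.sqrt_div Real.pi_pos.le, Real.sqrt_sq hpos.le]; field_simp
  · exact (integrable_exp_neg_mul_sq (by positivity)).integrableOn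
  · exact Filter.Eventually.of_forall fun _ => (Real.exp_pos _).le

theorem aux_pos (A B : Set (EuclideanSpace ℝ (Fin 3))) :
    2 * (∫⁻ x in A, ∫⁻ y in B, ENNReal.ofReal (‖x - y‖⁻¹)) ≤
     (∫⁻ x in A, ∫⁻ y in A, ENNReal.ofReal (‖x - y‖⁻¹)) +
     (∫⁻ x in B, ∫⁻ y in B, ENNReal.ofReal (‖x - y‖⁻¹)) := by
  have := aux_psd volume ((volume.restrict (Ioi (0:ℝ))).prod volume) auxH auxH_meas A B
  have key : ∀ A B : Set (EuclideanSpace ℝ (Fin 3)),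
     (∫⁻ x in A, ∫⁻ y in B, ∫⁻ p, auxH x p * auxH y p ∂((volume.restrict (Ioi (0:ℝ))).prod volume)) =
     ENNReal.ofReal (√Real.pi / 2) * (∫⁻ x in A, ∫⁻ y in B, ENNReal.ofReal (‖x - y‖⁻¹)) := by
    intro A B
    rw [← lintegral_const_mul' _ _ ENNReal.ofReal_ne_top]
    congr 1; ext x
    rw [← lintegral_const_mul' _ _ ENNReal.ofReal_ne_top]
    apply lintegral_congr_ae
    apply ae_restrict_of_ae
    have : ∀ᵐ y : EuclideanSpace ℝ (Fin 3), y ≠ x := by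
      simp [ae_iff]
    filter_upwards [this] with y hy
    exact auxH_ker x y hy.symm
  rw [key, key, key, ← mul_add, mul_left_comm] at this
  rwa [ENNReal.mul_le_mul_iff_right] at this
  · simp; positivity
  · exact ENNReal.ofReal_ne_top

theorem aux_radial (d R : ℝ) (hd : d ≠ 0) (hR : 0 ≤ R) :
    ∫⁻ r in Ioc 0 R, ENNReal.ofReal (r * (√(d ^ 2 + r ^ 2))⁻¹) =
      ENNReal.ofReal (√(d ^ 2 + R ^ 2) - |d|) := by
  have hpos : ∀ r : ℝ, 0 < d ^ 2 + r ^ 2 := fun r => by positivity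
  have hc : Continuous (fun r : ℝ => r * (√(d ^ 2 + r ^ 2))⁻¹) := by
    apply continuous_id.mul
    apply Continuous.inv₀ (by fun_prop)
    intro r
    exact (Real.sqrt_pos.2 (hpos r)).ne'
  rw [← ofReal_integral_eq_lintegral_ofReal, ← intervalIntegral.integral_of_le hR]
  · rw [intervalIntegral.integral_eq_sub_of_hasDerivAt (f := fun r => √(d ^ 2 + r ^ 2))]
    · simp [Real.sqrt_sq_eq_abs]
    · intro r _
      have := (((hasDerivAt_id r).pow 2).const_add (d ^ 2)).sqrt (hpos r).ne'
      refine this.congr_deriv ?_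
      have := Real.sqrt_pos.2 (hpos r)
      simp
      field_simp
    · exact hc.intervalIntegrable _ _
  · exact (hc.intervalIntegrable 0 R).1
  · filter_upwards [ae_restrict_mem measurableSet_Ioc] with r hr
    have := hr.1
    positivity

theorem aux_disc (a z : ℝ) (hz : a ≠ z) :
    ∫⁻ p : ℝ × ℝ, (if z ^ 2 + (p.1 ^ 2 + p.2 ^ 2) < 1 then
        ENNReal.ofReal ((√((a - z) ^ 2 + (p.1 ^ 2 + p.2 ^ 2)))⁻¹) else 0) =
     (Ioo (-1) 1).indicator
       (fun z => ENNReal.ofReal (2 * Real.pi * (√(1 + a ^ 2 - 2 * a * z) - |a - z|))) z := by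
  rw [← lintegral_comp_polarCoord_symm]
  have h1 : ∀ q : ℝ × ℝ, (polarCoord.symm q).1 ^ 2 + (polarCoord.symm q).2 ^ 2 = q.1 ^ 2 := by
    intro q
    simp only [polarCoord_symm_apply]
    linear_combination (q.1 ^ 2) * (Real.cos_sq_add_sin_sq q.2)
  simp_rw [h1]
  have ht : polarCoord.target = Ioi (0:ℝ) ×ˢ Ioo (-Real.pi) Real.pi := rfl
  rw [ht, Measure.volume_eq_prod, ← Measure.prod_restrict]
  have hm : Measurable (fun r : ℝ => ENNReal.ofReal r • (if z ^ 2 + r ^ 2 < 1 then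
        ENNReal.ofReal ((√((a - z) ^ 2 + r ^ 2))⁻¹) else 0)) := by
    apply Measurable.mul (by fun_prop)
    apply Measurable.ite _ (by fun_prop) (by fun_prop)
    exact measurableSet_lt (by fun_prop) (by fun_prop)
  have hm' : Measurable (fun p : ℝ × ℝ => ENNReal.ofReal p.1 • (if z ^ 2 + p.1 ^ 2 < 1 then
        ENNReal.ofReal ((√((a - z) ^ 2 + p.1 ^ 2))⁻¹) else 0)) := hm.comp measurable_fst
  rw [lintegral_prod _ hm'.aemeasurable]
  simp only [lintegral_const, Measure.restrict_apply_univ, Real.volume_Ioo]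
  rw [lintegral_mul_const _ hm]
  by_cases hz1 : z ∈ Ioo (-1 : ℝ) 1
  · rw [indicator_of_mem hz1]
    have hz2 : 0 < 1 - z ^ 2 := by nlinarith [hz1.1, hz1.2]
    have h2 : ∫⁻ r in Ioi (0:ℝ), ENNReal.ofReal r • (if z ^ 2 + r ^ 2 < 1 then
        ENNReal.ofReal ((√((a - z) ^ 2 + r ^ 2))⁻¹) else 0) =
        ∫⁻ r in Ioo 0 (√(1 - z ^ 2)), ENNReal.ofReal (r * (√((a - z) ^ 2 + r ^ 2))⁻¹) := by
      rw [← lintegral_indicator measurableSet_Ioi, ← lintegral_indicator measurableSet_Ioo]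
      congr 1; ext r
      by_cases hr : 0 < r
      · by_cases hr2 : r < √(1 - z ^ 2)
        · rw [indicator_of_mem (show r ∈ Ioi 0 from hr), indicator_of_mem (show r ∈ Ioo 0 _ from ⟨hr, hr2⟩)]
          rw [Real.lt_sqrt hr.le] at hr2
          rw [if_pos (by linarith), ENNReal.ofReal_mul hr.le, smul_eq_mul]
        · rw [indicator_of_mem (show r ∈ Ioi 0 from hr), indicator_of_notMem (fun h => hr2 h.2)]
          rw [Real.lt_sqrt hr.le] at hr2
          rw [if_neg (by intro h; apply hr2; linarith), smul_zero]
      · rw [indicator_of_notMem (by simpa using hr), indicator_of_notMem (fun h => hr h.1)]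
    rw [h2, setLIntegral_congr Ioo_ae_eq_Ioc, aux_radial _ _ (sub_ne_zero.2 hz) (Real.sqrt_nonneg _),
      Real.sq_sqrt hz2.le, mul_comm, ← ENNReal.ofReal_mul (by linarith [Real.pi_pos])]
    congr 1
    rw [show (a - z) ^ 2 + (1 - z ^ 2) = 1 + a ^ 2 - 2 * a * z by ring]
    ring
  · rw [indicator_of_notMem hz1]
    have : ∀ r : ℝ, ¬ (z ^ 2 + r ^ 2 < 1) := by
      intro r h
      apply hz1
      constructor <;> nlinarith [sq_nonneg r]
    simp [this]

theorem aux_slice (a : ℝ) :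
    ∫⁻ y in ball (0 : EuclideanSpace ℝ (Fin 3)) 1,
        ENNReal.ofReal (‖EuclideanSpace.single 0 a - y‖⁻¹) =
      ∫⁻ z in Ioo (-1 : ℝ) 1,
        ENNReal.ofReal (2 * Real.pi * (√(1 + a ^ 2 - 2 * a * z) - |a - z|)) := by
  rw [← lintegral_indicator measurableSet_ball]
  rw [← (PiLp.volume_preserving_toLp (Fin 3)).lintegral_comp_emb
    (MeasurableEquiv.toLp 2 _).measurableEmbedding]
  let G : ℝ × (ℝ × ℝ) → ENNReal := fun q => (if q.1 ^ 2 + (q.2.1 ^ 2 + q.2.2 ^ 2) < 1 then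
        ENNReal.ofReal ((√((a - q.1) ^ 2 + (q.2.1 ^ 2 + q.2.2 ^ 2)))⁻¹) else 0)
  have hG : Measurable G := by
    apply Measurable.ite _ (by fun_prop) (by fun_prop)
    exact measurableSet_lt (by fun_prop) (by fun_prop)
  have hmp := ((MeasurePreserving.id (volume : Measure ℝ)).prod
    (volume_preserving_finTwoArrow ℝ)).comp
    (volume_preserving_piFinSuccAbove (fun _ : Fin 3 => ℝ) 0)
  have h1 := hmp.lintegral_comp hG
  have h2 : ∀ w : Fin 3 → ℝ, (ball (0 : EuclideanSpace ℝ (Fin 3)) 1).indicator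
      (fun y => ENNReal.ofReal (‖EuclideanSpace.single 0 a - y‖⁻¹)) (WithLp.toLp 2 w) =
      G ((w 0, (w 1, w 2))) := by
    intro w
    have e1 : WithLp.toLp 2 w ∈ ball (0 : EuclideanSpace ℝ (Fin 3)) 1 ↔
       w 0 ^ 2 + (w 1 ^ 2 + w 2 ^ 2) < 1 := by
      rw [mem_ball_zero_iff, EuclideanSpace.norm_eq, Real.sqrt_lt' one_pos]
      simp [Fin.sum_univ_three, add_assoc]
    have e2 : ‖EuclideanSpace.single 0 a - WithLp.toLp 2 w‖ =
       √((a - w 0) ^ 2 + (w 1 ^ 2 + w 2 ^ 2)) := by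
      rw [EuclideanSpace.norm_eq]
      simp [Fin.sum_univ_three, add_assoc]
    simp only [indicator, e1, e2, G]
  simp_rw [h2]
  refine (Eq.trans ?_ h1).trans ?_
  · rfl
  · rw [Measure.volume_eq_prod, lintegral_prod _ hG.aemeasurable, ← lintegral_indicator measurableSet_Ioo]
    apply lintegral_congr_ae
    have : ∀ᵐ z : ℝ, z ≠ a := by simp [ae_iff]
    filter_upwards [this] with z hz
    exact aux_disc a z hz.symm

theorem aux_sqrt_int (a : ℝ) (ha : 0 < a) :
    ∫ z in (-1:ℝ)..1, √(1 + a ^ 2 - 2 * a * z) = ((1 + a) ^ 3 - |1 - a| ^ 3) / (3 * a) := by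
  rw [intervalIntegral.integral_eq_sub_of_hasDerivAt_of_le (by norm_num)
    (f := fun z => - (√(1 + a ^ 2 - 2 * a * z)) ^ 3 / (3 * a))]
  · rw [show 1 + a ^ 2 - 2 * a * 1 = (1 - a) ^ 2 by ring,
      show 1 + a ^ 2 - 2 * a * -1 = (1 + a) ^ 2 by ring, Real.sqrt_sq_eq_abs,
      Real.sqrt_sq (by positivity)]
    ring
  · fun_prop
  · intro z hz
    have hp : 0 < 1 + a ^ 2 - 2 * a * z := by nlinarith [hz.2, sq_nonneg (1 - a)]
    have h := ((((((hasDerivAt_id z).const_mul (2 * a)).const_sub (1 + a ^ 2)).sqrt hp.ne').pow 3).neg).div_const (3 * a)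
    refine h.congr_deriv ?_
    have := Real.sqrt_pos.2 hp
    simp
    field_simp
  · apply Continuous.intervalIntegrable
    fun_prop

theorem aux_slice_val (a : ℝ) (ha : 0 < a) :
    ∫⁻ z in Ioo (-1 : ℝ) 1,
        ENNReal.ofReal (2 * Real.pi * (√(1 + a ^ 2 - 2 * a * z) - |a - z|)) =
    ENNReal.ofReal (2 * Real.pi *
      (((1 + a) ^ 3 - |1 - a| ^ 3) / (3 * a) - ∫ z in (-1:ℝ)..1, |a - z|)) := by
  rw [setLIntegral_congr Ioo_ae_eq_Ioc]
  have hc : Continuous (fun z => 2 * Real.pi * (√(1 + a ^ 2 - 2 * a * z) - |a - z|)) := by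
    fun_prop
  rw [← ofReal_integral_eq_lintegral_ofReal, ← intervalIntegral.integral_of_le (by norm_num),
    intervalIntegral.integral_const_mul, intervalIntegral.integral_sub, aux_sqrt_int a ha]
  · apply Continuous.intervalIntegrable; fun_prop
  · apply Continuous.intervalIntegrable; fun_prop
  · exact (hc.intervalIntegrable _ _).1
  · filter_upwards [ae_restrict_mem measurableSet_Ioc] with z hz
    have : |a - z| ≤ √(1 + a ^ 2 - 2 * a * z) := by
      apply Real.le_sqrt_of_sq_le
      rw [sq_abs]
      nlinarith [hz.1, hz.2]
    have := Real.pi_pos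
    change (0:ℝ) ≤ _
    apply mul_nonneg (by positivity)
    linarith

theorem aux_abs_out (a : ℝ) (ha : 1 ≤ a) : ∫ z in (-1:ℝ)..1, |a - z| = 2 * a := by
  rw [intervalIntegral.integral_congr (g := fun z => a - z)]
  · rw [intervalIntegral.integral_sub (by simp) (by simp), intervalIntegral.integral_const, integral_id]
    norm_num
  · intro z hz
    rw [uIcc_of_le (by norm_num)] at hz
    exact abs_of_nonneg (by linarith [hz.2])

theorem aux_abs_in (a : ℝ) (ha0 : 0 < a) (ha : a < 1) : ∫ z in (-1:ℝ)..1, |a - z| = 1 + a ^ 2 := by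
  have hc : Continuous (fun z => |a - z|) := by fun_prop
  rw [← intervalIntegral.integral_add_adjacent_intervals (b := a) (hc.intervalIntegrable _ _) (hc.intervalIntegrable _ _)]
  rw [intervalIntegral.integral_congr (g := fun z => a - z),
    intervalIntegral.integral_congr (a := a) (g := fun z => z - a)]
  · rw [intervalIntegral.integral_sub (by simp) (by simp), intervalIntegral.integral_sub (by simp) (by simp)]
    simp; ring
  · intro z hz
    rw [uIcc_of_le ha.le] at hz
    simp only
    rw [abs_of_nonpos (by linarith [hz.1])]; ring
  · intro z hz
    rw [uIcc_of_le (by linarith)] at hz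
    exact abs_of_nonneg (by linarith [hz.2])

theorem aux_rot (x : EuclideanSpace ℝ (Fin 3)) :
    ∫⁻ y in ball (0 : EuclideanSpace ℝ (Fin 3)) 1, ENNReal.ofReal (‖x - y‖⁻¹) =
    ∫⁻ y in ball (0 : EuclideanSpace ℝ (Fin 3)) 1,
        ENNReal.ofReal (‖EuclideanSpace.single 0 ‖x‖ - y‖⁻¹) := by
  have hn : ‖x‖ = ‖(EuclideanSpace.single 0 ‖x‖ : EuclideanSpace ℝ (Fin 3))‖ := by simp
  have hr := Submodule.reflection_sub hn
  set L := (Submodule.span ℝ {x - EuclideanSpace.single 0 ‖x‖})ᗮ.reflection with hL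
  have hmp := L.measurePreserving
  rw [← lintegral_indicator measurableSet_ball, ← lintegral_indicator measurableSet_ball]
  rw [← hmp.lintegral_comp_emb L.toHomeomorph.measurableEmbedding
    ((ball (0 : EuclideanSpace ℝ (Fin 3)) 1).indicator (fun y => ENNReal.ofReal (‖EuclideanSpace.single 0 ‖x‖ - y‖⁻¹)))]
  congr 1; ext y
  have e1 : ‖EuclideanSpace.single 0 ‖x‖ - L y‖ = ‖x - y‖ := by
    rw [← hr, ← map_sub, L.norm_map]
  simp only [indicator, mem_ball_zero_iff, L.norm_map, e1]

theorem aux_shell_out (x : EuclideanSpace ℝ (Fin 3)) (hx : 1 ≤ ‖x‖) :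
    ∫⁻ y in ball (0 : EuclideanSpace ℝ (Fin 3)) 1, ENNReal.ofReal (‖x - y‖⁻¹) =
      ENNReal.ofReal (4 * Real.pi / 3) * ENNReal.ofReal (‖x‖⁻¹) := by
  have hp : 0 < ‖x‖ := by linarith
  rw [aux_rot, aux_slice, aux_slice_val _ hp, aux_abs_out _ hx,
    ← ENNReal.ofReal_mul (by positivity), abs_of_nonpos (by linarith)]
  congr 1
  field_simp
  ring

theorem aux_shell_le (x : EuclideanSpace ℝ (Fin 3)) (hx : x ≠ 0) :
    ∫⁻ y in ball (0 : EuclideanSpace ℝ (Fin 3)) 1, ENNReal.ofReal (‖x - y‖⁻¹) ≤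
      ENNReal.ofReal (4 * Real.pi / 3) * ENNReal.ofReal (‖x‖⁻¹) := by
  have hp : 0 < ‖x‖ := norm_pos_iff.2 hx
  rcases le_or_gt 1 ‖x‖ with h | h
  · exact (aux_shell_out x h).le
  rw [aux_rot, aux_slice, aux_slice_val _ hp, aux_abs_in _ hp h,
    ← ENNReal.ofReal_mul (by positivity), abs_of_nonneg (by linarith)]
  apply ENNReal.ofReal_le_ofReal
  generalize ‖x‖ = a at *
  have : 4 * Real.pi / 3 * a⁻¹ = 2 * Real.pi * (2 / (3 * a)) := by field_simp; norm_num
  rw [this]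
  apply mul_le_mul_of_nonneg_left _ (by positivity)
  rw [div_sub' (by positivity)]
  apply div_le_div_of_nonneg_right _ (by positivity)
  nlinarith [mul_nonneg (sq_nonneg (1 - a)) (by linarith : 0 ≤ a + 2)]

theorem aux_center_fin :
    ∫⁻ y in ball (0 : EuclideanSpace ℝ (Fin 3)) 1, ENNReal.ofReal (‖y‖⁻¹) ≠ ⊤ := by
  have h := aux_slice 0
  have : (EuclideanSpace.single 0 0 : EuclideanSpace ℝ (Fin 3)) = 0 := by simp
  simp only [this, zero_sub, norm_neg] at h
  rw [h]
  refine ((lintegral_mono (g := fun _ => ENNReal.ofReal (2 * Real.pi)) ?_).trans_lt ?_).ne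
  · intro z
    apply ENNReal.ofReal_le_ofReal
    have := Real.pi_pos
    simp
    nlinarith [abs_nonneg z]
  · simp [ENNReal.mul_lt_top_iff]

theorem aux_U_le (F : Set (EuclideanSpace ℝ (Fin 3))) (x : EuclideanSpace ℝ (Fin 3)) :
    ∫⁻ y in F, ENNReal.ofReal (‖x - y‖⁻¹) ≤
      (∫⁻ y in ball (0 : EuclideanSpace ℝ (Fin 3)) 1, ENNReal.ofReal (‖y‖⁻¹)) + volume F := by
  set f : EuclideanSpace ℝ (Fin 3) → ENNReal :=
    (ball (0 : EuclideanSpace ℝ (Fin 3)) 1).indicator (fun y => ENNReal.ofReal (‖y‖⁻¹)) with hf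
  have h1 : ∀ y, ENNReal.ofReal (‖x - y‖⁻¹) ≤ f (x - y) + 1 := by
    intro y
    by_cases h : ‖x - y‖ < 1
    · rw [hf, indicator_of_mem (by simpa using h)]
      exact le_self_add
    · refine le_trans ?_ le_add_self
      rw [← ENNReal.ofReal_one]
      exact ENNReal.ofReal_le_ofReal (inv_le_one_of_one_le₀ (not_lt.1 h))
  calc _ ≤ ∫⁻ y in F, (f (x - y) + 1) := lintegral_mono h1
    _ = (∫⁻ y in F, f (x - y)) + volume F := by
      rw [lintegral_add_right _ measurable_const]; simp
    _ ≤ (∫⁻ y, f (x - y)) + volume F := by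
      gcongr; exact Measure.restrict_le_self
    _ = _ := by
      rw [lintegral_sub_left_eq_self f x, hf, lintegral_indicator measurableSet_ball]

theorem aux_U_meas (F : Set (EuclideanSpace ℝ (Fin 3))) :
    Measurable (fun x => ∫⁻ y in F, ENNReal.ofReal (‖x - y‖⁻¹)) := by
  apply Measurable.lintegral_prod_right' (f := fun p : EuclideanSpace ℝ (Fin 3) × EuclideanSpace ℝ (Fin 3) =>
    ENNReal.ofReal (‖p.1 - p.2‖⁻¹))
  fun_prop

theorem aux_inner (F : Set (EuclideanSpace ℝ (Fin 3))) (x : EuclideanSpace ℝ (Fin 3)) :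
    ∫ y in F, ‖x - y‖⁻¹ = (∫⁻ y in F, ENNReal.ofReal (‖x - y‖⁻¹)).toReal := by
  rw [integral_eq_lintegral_of_nonneg_ae]
  · exact Filter.Eventually.of_forall fun y => by positivity
  · apply Measurable.aestronglyMeasurable; fun_prop

theorem aux_NL (F : Set (EuclideanSpace ℝ (Fin 3))) (hF : volume F ≠ ⊤) :
    NL F = (∫⁻ x in F, ∫⁻ y in F, ENNReal.ofReal (‖x - y‖⁻¹)).toReal := by
  have h1 : ∀ r : ℝ, r ^ (2 - ((3 : ℕ) : ℝ)) = r⁻¹ := by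
    intro r
    rw [show (2 - ((3 : ℕ) : ℝ)) = -1 by norm_num, Real.rpow_neg_one]
  unfold NL
  simp_rw [h1, aux_inner]
  rw [integral_toReal (aux_U_meas F).aemeasurable]
  refine Filter.Eventually.of_forall fun x => (aux_U_le F x).trans_lt ?_
  exact ENNReal.add_lt_top.2 ⟨aux_center_fin.lt_top, hF.lt_top⟩

theorem aux_D_fin (F G : Set (EuclideanSpace ℝ (Fin 3))) (hF : volume F ≠ ⊤) (hG : volume G ≠ ⊤) :
    (∫⁻ x in F, ∫⁻ y in G, ENNReal.ofReal (‖x - y‖⁻¹)) ≠ ⊤ := by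
  refine ((lintegral_mono fun x => aux_U_le G x).trans_lt ?_).ne
  rw [lintegral_const]
  apply ENNReal.mul_lt_top (ENNReal.add_lt_top.2 ⟨aux_center_fin.lt_top, hG.lt_top⟩)
  simpa using hF.lt_top

theorem aux_center (F : Set (EuclideanSpace ℝ (Fin 3))) :
    ∫ x in F, 2 / ‖x‖ = 2 * (∫⁻ y in F, ENNReal.ofReal (‖y‖⁻¹)).toReal := by
  have := aux_inner F 0
  simp only [zero_sub, norm_neg] at this
  rw [← this, ← integral_const_mul]
  rfl

theorem aux_mean (E : Set (EuclideanSpace ℝ (Fin 3))) (hE : MeasurableSet E) :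
    (∫⁻ x in ball (0 : EuclideanSpace ℝ (Fin 3)) 1, ∫⁻ y in ball (0 : EuclideanSpace ℝ (Fin 3)) 1,
        ENNReal.ofReal (‖x - y‖⁻¹)) +
      ENNReal.ofReal (4 * Real.pi / 3) * (∫⁻ y in E, ENNReal.ofReal (‖y‖⁻¹)) ≤
    (∫⁻ x in E, ∫⁻ y in ball (0 : EuclideanSpace ℝ (Fin 3)) 1, ENNReal.ofReal (‖x - y‖⁻¹)) +
      ENNReal.ofReal (4 * Real.pi / 3) *
        (∫⁻ y in ball (0 : EuclideanSpace ℝ (Fin 3)) 1, ENNReal.ofReal (‖y‖⁻¹)) := by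
  rw [← lintegral_const_mul' _ _ ENNReal.ofReal_ne_top, ← lintegral_const_mul' _ _ ENNReal.ofReal_ne_top]
  set B := ball (0 : EuclideanSpace ℝ (Fin 3)) 1 with hB
  have hBm : MeasurableSet B := measurableSet_ball
  set U := fun x => ∫⁻ y in B, ENNReal.ofReal (‖x - y‖⁻¹) with hU
  set V := fun x : EuclideanSpace ℝ (Fin 3) => ENNReal.ofReal (4 * Real.pi / 3) * ENNReal.ofReal (‖x‖⁻¹) with hV
  have h1 : ∫⁻ x in B \ E, U x ≤ ∫⁻ x in B \ E, V x := by
    apply lintegral_mono_ae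
    apply ae_restrict_of_ae
    have : ∀ᵐ y : EuclideanSpace ℝ (Fin 3), y ≠ 0 := by
      simp [ae_iff]
    filter_upwards [this] with x hx
    exact aux_shell_le x hx
  have h2 : ∫⁻ x in E \ B, U x = ∫⁻ x in E \ B, V x := by
    apply setLIntegral_congr_fun (hE.diff hBm)
    intro x hx
    apply aux_shell_out x
    have := hx.2
    simpa [hB] using this
  change (∫⁻ x in B, U x) + (∫⁻ x in E, V x) ≤ (∫⁻ x in E, U x) + (∫⁻ x in B, V x)
  rw [← lintegral_inter_add_sdiff U B hE, ← lintegral_inter_add_sdiff V E hBm,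
    ← lintegral_inter_add_sdiff U E hBm, ← lintegral_inter_add_sdiff V B hE, h2, inter_comm E B]
  calc _ ≤ (∫⁻ x in B ∩ E, U x) + (∫⁻ x in B \ E, V x) + ((∫⁻ x in B ∩ E, V x) + ∫⁻ x in E \ B, V x) := by
        gcongr
    _ = _ := by ring

/-- In dimension three: if the infimum defining `γ(E)` is attained at the origin,
then `NL(B_1) - NL(E) ≤ |B_1| γ(E)`. -/
theorem statement7 (E : Set (EuclideanSpace ℝ (Fin 3))) (hE : HasFinitePerimeter E)
    (hvol : volume E = volume (ball (0 : EuclideanSpace ℝ (Fin 3)) 1))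
    (hcenter : gammaAsym E =
      (∫ x in ball (0 : EuclideanSpace ℝ (Fin 3)) 1, 2 / ‖x‖) - ∫ x in E, 2 / ‖x‖) :
    NL (ball (0 : EuclideanSpace ℝ (Fin 3)) 1) - NL E ≤
      (volume (ball (0 : EuclideanSpace ℝ (Fin 3)) 1)).toReal * gammaAsym E := by
  have hBfin : volume (ball (0 : EuclideanSpace ℝ (Fin 3)) 1) ≠ ⊤ := measure_ball_lt_top.ne
  have hEfin : volume E ≠ ⊤ := hvol ▸ hBfin
  have hBvol : (volume (ball (0 : EuclideanSpace ℝ (Fin 3)) 1)).toReal = 4 * Real.pi / 3 := by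
    rw [EuclideanSpace.volume_ball_fin_three, ENNReal.toReal_mul, ENNReal.toReal_pow,
      ENNReal.toReal_ofReal (by norm_num), ENNReal.toReal_ofReal (by positivity)]
    ring
  have hW : ∀ F : Set (EuclideanSpace ℝ (Fin 3)), volume F ≠ ⊤ →
      (∫⁻ y in F, ENNReal.ofReal (‖y‖⁻¹)) ≠ ⊤ := by
    intro F hF
    have := aux_U_le F 0
    simp only [zero_sub, norm_neg] at this
    exact (this.trans_lt (ENNReal.add_lt_top.2 ⟨aux_center_fin.lt_top, hF.lt_top⟩)).ne
  have h1 := aux_pos E (ball (0 : EuclideanSpace ℝ (Fin 3)) 1)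
  have h2 := aux_mean E hE.1
  have f1 := aux_D_fin E E hEfin hEfin
  have f2 := aux_D_fin _ _ hBfin hBfin
  have f3 := aux_D_fin E _ hEfin hBfin
  have f4 := hW E hEfin
  have f5 := hW _ hBfin
  rw [hcenter, hBvol, aux_NL _ hBfin, aux_NL _ hEfin, aux_center, aux_center]
  rw [← ENNReal.toReal_le_toReal (ENNReal.mul_ne_top (by simp) f3) (ENNReal.add_ne_top.2 ⟨f1, f2⟩),
    ENNReal.toReal_add f1 f2, ENNReal.toReal_mul] at h1
  have g1 := ENNReal.mul_ne_top (ENNReal.ofReal_ne_top (r := 4 * Real.pi / 3)) f4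
  have g2 := ENNReal.mul_ne_top (ENNReal.ofReal_ne_top (r := 4 * Real.pi / 3)) f5
  rw [← ENNReal.toReal_le_toReal (ENNReal.add_ne_top.2 ⟨f2, g1⟩) (ENNReal.add_ne_top.2 ⟨f3, g2⟩),
    ENNReal.toReal_add f2 g1, ENNReal.toReal_add f3 g2, ENNReal.toReal_mul, ENNReal.toReal_mul,
    ENNReal.toReal_ofReal (by positivity)] at h2
  simp only [ENNReal.toReal_ofNat] at h1
  linarith
end

section
/- Let n ≥ 3 and let E ⊂ ℝⁿ be a measurable set with |E| = |B_1|. Define v(y) = ∫_{ℝⁿ} (χ_{B_1} − χ_E)(x) |x−y|^{2−n} dx and φ(r) = (1/H^{n−1}(∂B_r)) ∫_{∂B_r} v dH^{n−1} for r > 0. Then φ is nonincreasing on (0,∞). -/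
open MeasureTheory Metric Set

open Real Topology Filter

/-- Differentiation under the integral over a compact set. -/
lemma param_deriv {Z : Type*} [TopologicalSpace Z] [T2Space Z] [SecondCountableTopology Z] [MeasurableSpace Z]
    [BorelSpace Z] (μ : Measure Z) {K : Set Z} (hK : IsCompact K) (hμ : μ K ≠ ⊤)
    (k k' : ℝ → Z → ℝ) (s : Set ℝ) (hs : IsOpen s)
    (hk : ∀ t ∈ s, ContinuousOn (k t) K)
    (hk' : ContinuousOn (fun p : ℝ × Z => k' p.1 p.2) (s ×ˢ K))
    (hd : ∀ t ∈ s, ∀ y ∈ K, HasDerivAt (fun t => k t y) (k' t y) t) (t : ℝ) (ht : t ∈ s) :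
    HasDerivAt (fun t => ∫ y in K, k t y ∂μ) (∫ y in K, k' t y ∂μ) t := by
  obtain ⟨ε, hε, hb⟩ := Metric.nhds_basis_closedBall.mem_iff.1 (hs.mem_nhds ht)
  have hc : IsCompact (closedBall t ε ×ˢ K) := (isCompact_closedBall t ε).prod hK
  obtain ⟨C, hC⟩ := hc.exists_bound_of_continuousOn (hk'.mono (prod_mono hb le_rfl))
  have hm : MeasurableSet K := hK.measurableSet
  have hfin : IsFiniteMeasure (μ.restrict K) := ⟨by simpa using hμ.lt_top⟩
  have hk1 : ∀ t ∈ s, AEStronglyMeasurable (k t) (μ.restrict K) := fun t ht =>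
    (hk t ht).aestronglyMeasurable hm
  have hk2 : ContinuousOn (k' t) K := by
    have : ContinuousOn (fun y : Z => ((t, y) : ℝ × Z)) K := by fun_prop
    exact hk'.comp this (fun y hy => ⟨ht, hy⟩)
  refine (hasDerivAt_integral_of_dominated_loc_of_deriv_le (s := closedBall t ε)
    (bound := fun _ => C) (closedBall_mem_nhds t hε) ?_ ?_ ?_ ?_ (integrable_const C) ?_).2
  · filter_upwards [hs.mem_nhds ht] with x hx using hk1 x hx
  · obtain ⟨C', hC'⟩ := hK.exists_bound_of_continuousOn (hk t ht)
    refine Integrable.of_bound (hk1 t ht) C' ?_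
    exact (ae_restrict_iff' hm).2 (Eventually.of_forall hC')
  · exact hk2.aestronglyMeasurable hm
  · exact (ae_restrict_iff' hm).2 (Eventually.of_forall fun y hy x hx => hC (x, y) ⟨hx, hy⟩)
  · exact (ae_restrict_iff' hm).2 (Eventually.of_forall fun y hy x hx => hd x (hb hx) y hy)

lemma D_pos {a r v : ℝ} (h : |a| < r) (hv : |v| ≤ r) : 0 < a ^ 2 + r ^ 2 - 2 * a * v := by
  have h1 : a * v ≤ |a| * r := by
    calc a * v ≤ |a * v| := le_abs_self _
      _ = |a| * |v| := abs_mul _ _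
      _ ≤ |a| * r := by gcongr
  nlinarith [sq_abs a, sq_pos_of_pos (sub_pos.2 h)]

lemma coord_le {n : ℕ} {r : ℝ} (hr : 0 < r) (y : EuclideanSpace ℝ (Fin n))
    (hy : y ∈ sphere (0 : EuclideanSpace ℝ (Fin n)) r) (i : Fin n) : |y i| ≤ r := by
  have : ‖y‖ = r := by simpa using hy
  rw [← this]; simpa using PiLp.norm_apply_le y i

lemma coord_two {n : ℕ} {r : ℝ} (hr : 0 < r) (y : EuclideanSpace ℝ (Fin n))
    (hy : y ∈ sphere (0 : EuclideanSpace ℝ (Fin n)) r) (i j : Fin n) (hij : i ≠ j) (θ : ℝ) :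
    |cos θ * y i + sin θ * y j| ≤ r := by
  have h1 : ‖y‖ = r := by simpa using hy
  have h2 : y i ^ 2 + y j ^ 2 ≤ r ^ 2 := by
    rw [← h1, EuclideanSpace.real_norm_sq_eq]
    calc y i ^ 2 + y j ^ 2 = ∑ k ∈ {i, j}, y k ^ 2 := by rw [Finset.sum_pair hij]
      _ ≤ _ := Finset.sum_le_univ_sum_of_nonneg (fun k => sq_nonneg _)
  apply abs_le_of_sq_le_sq _ hr.le
  nlinarith [sq_nonneg (sin θ * y i - cos θ * y j), sin_sq_add_cos_sq θ]

/-- rotation invariance, as a property of integrals over the sphere -/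
def RotInv {n : ℕ} (μ : Measure (EuclideanSpace ℝ (Fin n))) (r : ℝ) : Prop :=
  ∀ (ρ : EuclideanSpace ℝ (Fin n) ≃ₗᵢ[ℝ] EuclideanSpace ℝ (Fin n))
    (f : EuclideanSpace ℝ (Fin n) → ℝ),
    ∫ y in sphere 0 r, f (ρ y) ∂μ = ∫ y in sphere 0 r, f y ∂μ

lemma rotInv_hausdorff {n : ℕ} (d r : ℝ) :
    RotInv (μH[d] : Measure (EuclideanSpace ℝ (Fin n))) r := by
  intro ρ f
  have h := (ρ.toIsometryEquiv.measurePreserving_hausdorffMeasure d)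
  have h2 := h.setIntegral_preimage_emb ρ.toHomeomorph.measurableEmbedding f (sphere 0 r)
  have h3 : (ρ.toIsometryEquiv ⁻¹' sphere 0 r) = sphere (0 : EuclideanSpace ℝ (Fin n)) r := by
    ext y; simp
  rw [h3] at h2
  exact h2

lemma rot_const {n : ℕ} (μ : Measure (EuclideanSpace ℝ (Fin n))) (r : ℝ) (hinv : RotInv μ r)
    (G : ℝ → ℝ) (i j : Fin n) (hij : i ≠ j) (θ : ℝ) :
    ∫ y in sphere 0 r, (sin θ * y i - cos θ * y j) * G (cos θ * y i + sin θ * y j) ∂μ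
      = ∫ y in sphere 0 r, y j * G (y i) ∂μ := by
  set w : EuclideanSpace ℝ (Fin n) :=
    EuclideanSpace.single i (cos (θ/2)) + EuclideanSpace.single j (sin (θ/2)) with hw
  have hwi : w i = cos (θ/2) := by simp [hw, hij]
  have hwj : w j = sin (θ/2) := by simp [hw, hij.symm]
  have hin : ∀ y, inner ℝ w y = cos (θ/2) * y i + sin (θ/2) * y j := by
    intro y
    simp [hw, inner_add_left, EuclideanSpace.inner_single_left]
  have hn : ‖w‖ ^ 2 = 1 := by
    rw [← real_inner_self_eq_norm_sq, hin, hwi, hwj]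
    nlinarith [sin_sq_add_cos_sq (θ/2)]
  have hθ1 : cos θ = 2 * cos (θ/2) ^ 2 - 1 := by rw [← cos_two_mul]; congr 1; ring
  have hθ2 : sin θ = 2 * sin (θ/2) * cos (θ/2) := by rw [← sin_two_mul]; congr 1; ring
  have hs := sin_sq_add_cos_sq (θ/2)
  rw [← hinv (Submodule.reflection (ℝ ∙ w)) (fun y => y j * G (y i))]
  congr 1
  ext y
  have hr : Submodule.reflection (ℝ ∙ w) y = 2 • (inner ℝ w y) • w - y := by
    rw [Submodule.reflection_singleton_apply]
    simp [hn]
  have e1 : (Submodule.reflection (ℝ ∙ w) y) i = cos θ * y i + sin θ * y j := by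
    rw [hr]; simp [hwi, hin, hθ1, hθ2]; ring
  have e2 : (Submodule.reflection (ℝ ∙ w) y) j = sin θ * y i - cos θ * y j := by
    rw [hr]; simp [hwj, hin, hθ1, hθ2]; linear_combination 2 * y j * hs
  rw [e1, e2]

/-- The infinitesimal rotation identity. -/
lemma rot_ident {n : ℕ} (μ : Measure (EuclideanSpace ℝ (Fin n))) {r : ℝ} (hr : 0 < r)
    (hμ : μ (sphere 0 r) ≠ ⊤) (hinv : RotInv μ r)
    (a q : ℝ) (ha : |a| < r) (i j : Fin n) (hij : i ≠ j) :
    ∫ y in sphere 0 r, (y i * (a ^ 2 + r ^ 2 - 2 * a * y i) ^ q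
      + 2 * a * q * (y j ^ 2 * (a ^ 2 + r ^ 2 - 2 * a * y i) ^ (q - 1))) ∂μ = 0 := by
  have hK : IsCompact (sphere (0 : EuclideanSpace ℝ (Fin n)) r) := isCompact_sphere _ _
  have hD : ∀ θ : ℝ, ∀ y ∈ sphere (0 : EuclideanSpace ℝ (Fin n)) r,
      0 < a ^ 2 + r ^ 2 - 2 * a * (cos θ * y i + sin θ * y j) := fun θ y hy =>
    D_pos ha (coord_two hr y hy i j hij θ)
  have h := param_deriv μ hK hμ
    (fun θ y => (sin θ * y i - cos θ * y j) *
      (a ^ 2 + r ^ 2 - 2 * a * (cos θ * y i + sin θ * y j)) ^ q)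
    (fun θ y => (cos θ * y i + sin θ * y j) *
      (a ^ 2 + r ^ 2 - 2 * a * (cos θ * y i + sin θ * y j)) ^ q
      + (sin θ * y i - cos θ * y j) * ((2 * a * (sin θ * y i - cos θ * y j)) * q *
      (a ^ 2 + r ^ 2 - 2 * a * (cos θ * y i + sin θ * y j)) ^ (q - 1)))
    univ isOpen_univ
    (by
      intro t _
      refine ContinuousOn.mul (by fun_prop) (ContinuousOn.rpow_const (by fun_prop) ?_)
      intro y hy; exact Or.inl (hD t y hy).ne')
    (by
      refine ContinuousOn.add (ContinuousOn.mul (by fun_prop)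
          (ContinuousOn.rpow_const (by fun_prop) ?_))
        (ContinuousOn.mul (by fun_prop) (ContinuousOn.mul (by fun_prop)
          (ContinuousOn.rpow_const (by fun_prop) ?_)))
      · rintro ⟨t, y⟩ hy; exact Or.inl (hD t y hy.2).ne'
      · rintro ⟨t, y⟩ hy; exact Or.inl (hD t y hy.2).ne')
    (by
      intro t _ y hy
      have h1 : HasDerivAt (fun t => sin t * y i - cos t * y j) (cos t * y i + sin t * y j) t := by
        exact (((hasDerivAt_sin t).mul_const (y i)).sub
          ((hasDerivAt_cos t).mul_const (y j))).congr_deriv (by ring)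
      have h2 : HasDerivAt (fun t => a ^ 2 + r ^ 2 - 2 * a * (cos t * y i + sin t * y j))
          (2 * a * (sin t * y i - cos t * y j)) t := by
        exact (((((hasDerivAt_cos t).mul_const (y i)).add
          ((hasDerivAt_sin t).mul_const (y j))).const_mul (2 * a)).const_sub
            (a ^ 2 + r ^ 2)).congr_deriv (by ring)
      exact h1.mul (h2.rpow_const (Or.inl (hD t y hy).ne')))
    0 (mem_univ _)
  have hc : (fun θ : ℝ => ∫ y in sphere (0 : EuclideanSpace ℝ (Fin n)) r,
      (sin θ * y i - cos θ * y j) *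
      (a ^ 2 + r ^ 2 - 2 * a * (cos θ * y i + sin θ * y j)) ^ q ∂μ) = fun _ =>
      ∫ y in sphere (0 : EuclideanSpace ℝ (Fin n)) r, y j * (a ^ 2 + r ^ 2 - 2 * a * (y i)) ^ q ∂μ := by
    ext θ
    exact rot_const μ r hinv (fun v => (a ^ 2 + r ^ 2 - 2 * a * v) ^ q) i j hij θ
  rw [hc] at h
  have := h.unique (hasDerivAt_const _ _)
  rw [← this]
  congr 1
  ext y
  simp
  ring


lemma int_on {n : ℕ} (μ : Measure (EuclideanSpace ℝ (Fin n))) {r : ℝ}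
    (hμ : μ (sphere 0 r) ≠ ⊤) (f : EuclideanSpace ℝ (Fin n) → ℝ)
    (hf : ContinuousOn f (sphere 0 r)) : Integrable f (μ.restrict (sphere 0 r)) := by
  have hK : IsCompact (sphere (0 : EuclideanSpace ℝ (Fin n)) r) := isCompact_sphere _ _
  have hfin : IsFiniteMeasure (μ.restrict (sphere (0 : EuclideanSpace ℝ (Fin n)) r)) :=
    ⟨by simpa using hμ.lt_top⟩
  obtain ⟨C', hC'⟩ := hK.exists_bound_of_continuousOn hf
  refine Integrable.of_bound (hf.aestronglyMeasurable hK.measurableSet) C' ?_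
  exact (ae_restrict_iff' hK.measurableSet).2 (Eventually.of_forall hC')

lemma rot_sum {m : ℕ} (μ : Measure (EuclideanSpace ℝ (Fin (m+1)))) {r : ℝ} (hr : 0 < r)
    (hμ : μ (sphere 0 r) ≠ ⊤) (hinv : RotInv μ r)
    (a q : ℝ) (ha : |a| < r) :
    ∫ y in sphere 0 r, ((m : ℝ) * y 0 * (a ^ 2 + r ^ 2 - 2 * a * y 0) ^ q
      + 2 * a * q * ((r ^ 2 - y 0 ^ 2) * (a ^ 2 + r ^ 2 - 2 * a * y 0) ^ (q - 1))) ∂μ = 0 := by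
  have hD : ∀ y ∈ sphere (0 : EuclideanSpace ℝ (Fin (m+1))) r,
      0 < a ^ 2 + r ^ 2 - 2 * a * y 0 := fun y hy => D_pos ha (coord_le hr y hy 0)
  have h1 : ∀ j : Fin m, ∫ y in sphere 0 r, (y 0 * (a ^ 2 + r ^ 2 - 2 * a * y 0) ^ q
      + 2 * a * q * (y j.succ ^ 2 * (a ^ 2 + r ^ 2 - 2 * a * y 0) ^ (q - 1))) ∂μ = 0 :=
    fun j => rot_ident μ hr hμ hinv a q ha 0 j.succ (Fin.succ_ne_zero j).symm
  have h2 := integral_finsetSum (μ := μ.restrict (sphere 0 r)) (Finset.univ : Finset (Fin m))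
    (f := fun j y => (y 0 * (a ^ 2 + r ^ 2 - 2 * a * y 0) ^ q
      + 2 * a * q * (y j.succ ^ 2 * (a ^ 2 + r ^ 2 - 2 * a * y 0) ^ (q - 1)))) (by
      intro j _
      apply int_on μ hμ
      refine ContinuousOn.add (ContinuousOn.mul (by fun_prop)
          (ContinuousOn.rpow_const (by fun_prop) ?_))
        (ContinuousOn.mul (by fun_prop) (ContinuousOn.mul (by fun_prop)
          (ContinuousOn.rpow_const (by fun_prop) ?_)))
      · intro y hy; exact Or.inl (hD y hy).ne'
      · intro y hy; exact Or.inl (hD y hy).ne')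
  simp only [h1, Finset.sum_const_zero] at h2
  rw [← h2]
  apply setIntegral_congr_fun (isClosed_sphere.measurableSet)
  intro y hy
  have h3 : ‖y‖ = r := by simpa using hy
  have h4 : r ^ 2 = y 0 ^ 2 + ∑ j : Fin m, y j.succ ^ 2 := by
    rw [← h3, EuclideanSpace.real_norm_sq_eq, Fin.sum_univ_succ]
  simp only [Finset.sum_add_distrib, ← Finset.mul_sum, ← Finset.sum_mul, Finset.sum_const,
    Finset.card_univ, Fintype.card_fin, nsmul_eq_mul]
  have h5 : r ^ 2 - y 0 ^ 2 = ∑ j : Fin m, y j.succ ^ 2 := by linarith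
  rw [h5]; ring

lemma K_zero {m : ℕ} (hm : 2 ≤ m) (μ : Measure (EuclideanSpace ℝ (Fin (m+1)))) {r : ℝ} (hr : 0 < r)
    (hμ : μ (sphere 0 r) ≠ ⊤) (hinv : RotInv μ r) (a : ℝ) (ha0 : 0 < a) (ha : a < r) :
    ∫ y in sphere 0 r, (y 0 - a) * (a ^ 2 + r ^ 2 - 2 * a * y 0) ^ (-((m : ℝ) + 1) / 2) ∂μ = 0 := by
  set q : ℝ := -((m : ℝ) + 1) / 2 with hq
  have hK : IsCompact (sphere (0 : EuclideanSpace ℝ (Fin (m+1))) r) := isCompact_sphere _ _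
  have hD : ∀ a ∈ Ioo (-r) r, ∀ y ∈ sphere (0 : EuclideanSpace ℝ (Fin (m+1))) r,
      0 < a ^ 2 + r ^ 2 - 2 * a * y 0 := fun a ha y hy =>
    D_pos (abs_lt.2 ha) (coord_le hr y hy 0)
  have hd := param_deriv μ hK hμ
    (fun a y => a ^ m * ((y 0 - a) * (a ^ 2 + r ^ 2 - 2 * a * y 0) ^ q))
    (fun a y => a ^ (m - 1) * ((m : ℝ) * y 0 * (a ^ 2 + r ^ 2 - 2 * a * y 0) ^ q
      + 2 * a * q * ((r ^ 2 - y 0 ^ 2) * (a ^ 2 + r ^ 2 - 2 * a * y 0) ^ (q - 1))))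
    (Ioo (-r) r) isOpen_Ioo
    (by
      intro t ht
      refine ContinuousOn.mul (by fun_prop) (ContinuousOn.mul (by fun_prop)
        (ContinuousOn.rpow_const (by fun_prop) ?_))
      intro y hy; exact Or.inl (hD t ht y hy).ne')
    (by
      refine ContinuousOn.mul (by fun_prop) (ContinuousOn.add (ContinuousOn.mul (by fun_prop)
          (ContinuousOn.rpow_const (by fun_prop) ?_))
        (ContinuousOn.mul (by fun_prop) (ContinuousOn.mul (by fun_prop)
          (ContinuousOn.rpow_const (by fun_prop) ?_))))
      · rintro ⟨t, y⟩ hy; exact Or.inl (hD t hy.1 y hy.2).ne'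
      · rintro ⟨t, y⟩ hy; exact Or.inl (hD t hy.1 y hy.2).ne')
    (by
      intro t ht y hy
      have hp := hD t ht y hy
      have h1 : HasDerivAt (fun t => t ^ 2 + r ^ 2 - 2 * t * y 0) (2 * t - 2 * y 0) t :=
        ((((hasDerivAt_id t).pow 2).add_const (r ^ 2)).sub
          (((hasDerivAt_id t).const_mul 2).mul_const (y 0))).congr_deriv (by simp)
      have h2 := (hasDerivAt_pow m t).mul
        (((hasDerivAt_id t).const_sub (y 0)).mul (h1.rpow_const (p := q) (Or.inl hp.ne')))
      refine h2.congr_deriv ?_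
      have e1 : (t ^ 2 + r ^ 2 - 2 * t * y 0) ^ q
          = (t ^ 2 + r ^ 2 - 2 * t * y 0) ^ (q - 1) * (t ^ 2 + r ^ 2 - 2 * t * y 0) := by
        rw [← rpow_add_one hp.ne']; congr 1; ring
      have e2 : t ^ m = t ^ (m - 1) * t := by
        rw [← pow_succ]; congr 1; omega
      simp only [id, Pi.mul_apply]
      rw [e1, e2, hq]
      ring)
  have hz : ∀ t ∈ Ioo (-r) r, ∫ y in sphere (0 : EuclideanSpace ℝ (Fin (m+1))) r,
     t ^ (m - 1) * ((m : ℝ) * y 0 * (t ^ 2 + r ^ 2 - 2 * t * y 0) ^ q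
      + 2 * t * q * ((r ^ 2 - y 0 ^ 2) * (t ^ 2 + r ^ 2 - 2 * t * y 0) ^ (q - 1))) ∂μ = 0 := by
    intro t ht
    rw [integral_const_mul, rot_sum μ hr hμ hinv t q (abs_lt.2 ht), mul_zero]
  have hsub : ∀ t ∈ Icc 0 a, t ∈ Ioo (-r) r := fun t ht => ⟨by linarith [ht.1], by linarith [ht.2]⟩
  obtain ⟨c, hc, hc'⟩ := exists_hasDerivAt_eq_slope _ _ ha0
    (fun t ht => (hd t (hsub t ht)).continuousAt.continuousWithinAt)
    (fun t ht => hd t (hsub t (Ioo_subset_Icc_self ht)))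
  rw [hz c (hsub c (Ioo_subset_Icc_self hc))] at hc'
  have h0 : (0 : ℝ) ^ m = 0 := by simp; omega
  simp only [h0, zero_mul, integral_zero, sub_zero, integral_const_mul] at hc'
  rw [eq_comm, div_eq_zero_iff, mul_eq_zero] at hc'
  rcases hc' with (h | h) | h
  · exact absurd h (pow_ne_zero _ ha0.ne')
  · exact h
  · exact absurd h ha0.ne'

lemma shell_in {m : ℕ} (hm : 2 ≤ m) (μ : Measure (EuclideanSpace ℝ (Fin (m+1)))) {r : ℝ} (hr : 0 < r)
    (hμ : μ (sphere 0 r) ≠ ⊤) (hinv : RotInv μ r) (a : ℝ) (ha0 : 0 ≤ a) (ha : a < r) :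
    ∫ y in sphere 0 r, (a ^ 2 + r ^ 2 - 2 * a * y 0) ^ ((1 - (m : ℝ)) / 2) ∂μ
      = (μ (sphere 0 r)).toReal * r ^ (1 - (m : ℝ)) := by
  have hK : IsCompact (sphere (0 : EuclideanSpace ℝ (Fin (m+1))) r) := isCompact_sphere _ _
  have hD : ∀ a ∈ Ioo (-r) r, ∀ y ∈ sphere (0 : EuclideanSpace ℝ (Fin (m+1))) r,
      0 < a ^ 2 + r ^ 2 - 2 * a * y 0 := fun a ha y hy =>
    D_pos (abs_lt.2 ha) (coord_le hr y hy 0)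
  have h0 : ∫ y in sphere (0 : EuclideanSpace ℝ (Fin (m+1))) r,
      ((0:ℝ) ^ 2 + r ^ 2 - 2 * 0 * y 0) ^ ((1 - (m : ℝ)) / 2) ∂μ
      = (μ (sphere 0 r)).toReal * r ^ (1 - (m : ℝ)) := by
    have : ((r:ℝ) ^ 2) ^ ((1 - (m : ℝ)) / 2) = r ^ (1 - (m : ℝ)) := by
      rw [← rpow_natCast, ← rpow_mul hr.le]; congr 1; push_cast; ring
    simp [this, Measure.real]
  rcases ha0.eq_or_lt with rfl | ha0
  · exact h0
  have hd := param_deriv μ hK hμ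
    (fun a y => (a ^ 2 + r ^ 2 - 2 * a * y 0) ^ ((1 - (m : ℝ)) / 2))
    (fun a y => ((m : ℝ) - 1) * ((y 0 - a) * (a ^ 2 + r ^ 2 - 2 * a * y 0) ^ (-((m : ℝ) + 1) / 2)))
    (Ioo (-r) r) isOpen_Ioo
    (by
      intro t ht
      refine ContinuousOn.rpow_const (by fun_prop) ?_
      intro y hy; exact Or.inl (hD t ht y hy).ne')
    (by
      refine ContinuousOn.mul (by fun_prop) (ContinuousOn.mul (by fun_prop)
          (ContinuousOn.rpow_const (by fun_prop) ?_))
      rintro ⟨t, y⟩ hy; exact Or.inl (hD t hy.1 y hy.2).ne')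
    (by
      intro t ht y hy
      have hp := hD t ht y hy
      have h1 : HasDerivAt (fun t => t ^ 2 + r ^ 2 - 2 * t * y 0) (2 * t - 2 * y 0) t :=
        ((((hasDerivAt_id t).pow 2).add_const (r ^ 2)).sub
          (((hasDerivAt_id t).const_mul 2).mul_const (y 0))).congr_deriv (by simp)
      refine (h1.rpow_const (Or.inl hp.ne')).congr_deriv ?_
      have : (1 - (m : ℝ)) / 2 - 1 = -((m : ℝ) + 1) / 2 := by ring
      rw [this]; ring)
  have hsub : ∀ t ∈ Icc 0 a, t ∈ Ioo (-r) r := fun t ht => ⟨by linarith [ht.1], by linarith [ht.2]⟩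
  obtain ⟨c, hc, hc'⟩ := exists_hasDerivAt_eq_slope _ _ ha0
    (fun t ht => (hd t (hsub t ht)).continuousAt.continuousWithinAt)
    (fun t ht => hd t (hsub t (Ioo_subset_Icc_self ht)))
  rw [integral_const_mul, K_zero hm μ hr hμ hinv c hc.1 (hc.2.trans ha), mul_zero, h0] at hc'
  rw [eq_comm, div_eq_zero_iff] at hc'
  rcases hc' with h | h <;> linarith

/-- Newton's shell theorem. -/
lemma shell {m : ℕ} (hm : 2 ≤ m) (μ : Measure (EuclideanSpace ℝ (Fin (m+1)))) {r : ℝ} (hr : 0 < r)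
    (hμ : μ (sphere 0 r) ≠ ⊤) (hinv : RotInv μ r) (x : EuclideanSpace ℝ (Fin (m+1)))
    (hx : ‖x‖ ≠ r) :
    ∫ y in sphere 0 r, ‖x - y‖ ^ (1 - (m : ℝ)) ∂μ
      = (μ (sphere 0 r)).toReal * (max ‖x‖ r) ^ (1 - (m : ℝ)) := by
  set a := ‖x‖ with ha
  have ha0 : 0 ≤ a := norm_nonneg x
  set z : EuclideanSpace ℝ (Fin (m+1)) := EuclideanSpace.single 0 a with hz
  have hzn : ‖x‖ = ‖z‖ := by simp [hz, ha]
  set ρ := Submodule.reflection (ℝ ∙ (x - z))ᗮ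
  have hρ : ρ x = z := Submodule.reflection_sub hzn
  have h1 : ∫ y in sphere 0 r, ‖x - y‖ ^ (1 - (m : ℝ)) ∂μ
      = ∫ y in sphere 0 r, (a ^ 2 + r ^ 2 - 2 * a * y 0) ^ ((1 - (m : ℝ)) / 2) ∂μ := by
    rw [← hinv ρ (fun y => (a ^ 2 + r ^ 2 - 2 * a * y 0) ^ ((1 - (m : ℝ)) / 2))]
    apply setIntegral_congr_fun (isClosed_sphere.measurableSet)
    intro y hy
    have h3 : ‖y‖ = r := by simpa using hy
    have h4 : ‖x - y‖ ^ 2 = a ^ 2 + r ^ 2 - 2 * a * (ρ y) 0 := by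
      rw [← ρ.norm_map, map_sub, hρ, @norm_sub_sq_real, ← hzn, ρ.norm_map, h3]
      simp [hz, EuclideanSpace.inner_single_left]
      ring
    simp only
    rw [← h4, ← rpow_natCast, ← rpow_mul (norm_nonneg _)]
    congr 1; push_cast; ring
  rw [h1]
  rcases lt_or_gt_of_ne hx with h | h
  · rw [max_eq_right h.le]; exact shell_in hm μ hr hμ hinv a ha0 h
  · rw [max_eq_left h.le]
    have hap : 0 < a := hr.trans h
    have hb : r ^ 2 / a < r := by rw [div_lt_iff₀ hap]; nlinarith
    have h5 := shell_in hm μ hr hμ hinv (r ^ 2 / a) (by positivity) hb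
    have h6 : ∫ y in sphere 0 r, (a ^ 2 + r ^ 2 - 2 * a * y 0) ^ ((1 - (m : ℝ)) / 2) ∂μ
       = ∫ y in sphere 0 r, (a / r) ^ (1 - (m : ℝ)) *
        ((r ^ 2 / a) ^ 2 + r ^ 2 - 2 * (r ^ 2 / a) * y 0) ^ ((1 - (m : ℝ)) / 2) ∂μ := by
      apply setIntegral_congr_fun (isClosed_sphere.measurableSet)
      intro y hy
      have hp : 0 < (r ^ 2 / a) ^ 2 + r ^ 2 - 2 * (r ^ 2 / a) * y 0 :=
        D_pos (by rwa [abs_of_nonneg (by positivity)]) (coord_le hr y hy 0)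
      have e1 : a ^ 2 + r ^ 2 - 2 * a * y 0
          = (a / r) ^ 2 * ((r ^ 2 / a) ^ 2 + r ^ 2 - 2 * (r ^ 2 / a) * y 0) := by
        field_simp; ring
      have e2 : ((a / r) ^ 2) ^ ((1 - (m : ℝ)) / 2) = (a / r) ^ (1 - (m : ℝ)) := by
        rw [← rpow_natCast, ← rpow_mul (by positivity)]; congr 1; push_cast; ring
      simp only
      rw [e1, mul_rpow (by positivity) hp.le, e2]
    rw [h6, integral_const_mul, h5, div_rpow hap.le hr.le]
    have : r ^ (1 - (m : ℝ)) ≠ 0 := (rpow_pos_of_pos hr _).ne'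
    field_simp


section main

variable {m : ℕ}

lemma fE_meas {E : Set (EuclideanSpace ℝ (Fin (m+1)))} (hE : MeasurableSet E) :
    Measurable (fE E) := by
  unfold fE
  exact (measurable_one.indicator measurableSet_ball).sub (measurable_one.indicator hE)

lemma fE_integrable {E : Set (EuclideanSpace ℝ (Fin (m+1)))} (hE : MeasurableSet E)
    (hvol : volume E = volume (ball (0 : EuclideanSpace ℝ (Fin (m+1))) 1)) :
    Integrable (fE E) := by
  have hb : volume (ball (0 : EuclideanSpace ℝ (Fin (m+1))) 1) < ⊤ := measure_ball_lt_top
  unfold fE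
  exact ((integrable_indicator_iff measurableSet_ball).2 (integrableOn_const hb.ne)).sub
    ((integrable_indicator_iff hE).2 (integrableOn_const (by rw [hvol]; exact hb.ne)))

lemma fE_integral {E : Set (EuclideanSpace ℝ (Fin (m+1)))} (hE : MeasurableSet E)
    (hvol : volume E = volume (ball (0 : EuclideanSpace ℝ (Fin (m+1))) 1)) :
    ∫ x, fE E x = 0 := by
  have hb : volume (ball (0 : EuclideanSpace ℝ (Fin (m+1))) 1) < ⊤ := measure_ball_lt_top
  unfold fE
  rw [integral_sub ((integrable_indicator_iff measurableSet_ball).2 (integrableOn_const hb.ne))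
    ((integrable_indicator_iff hE).2 (integrableOn_const (by rw [hvol]; exact hb.ne))),
    integral_indicator_one measurableSet_ball, integral_indicator_one hE]
  simp [Measure.real, hvol]

lemma max_meas (r p : ℝ) : Measurable (fun x : EuclideanSpace ℝ (Fin (m+1)) => (max ‖x‖ r) ^ p) := by
  fun_prop

lemma max_bound {r : ℝ} (hr : 0 < r) (hm : 2 ≤ m) (x : EuclideanSpace ℝ (Fin (m+1))) :
    ‖(max ‖x‖ r) ^ (1 - (m : ℝ))‖ ≤ r ^ (1 - (m : ℝ)) := by
  have hm' : (2 : ℝ) ≤ m := by exact_mod_cast hm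
  have h0 : 0 < max ‖x‖ r := lt_max_of_lt_right hr
  rw [norm_of_nonneg (rpow_nonneg h0.le _)]
  exact rpow_le_rpow_of_nonpos hr (le_max_right _ _) (by linarith)

lemma fE_max_int {r : ℝ} (hr : 0 < r) (hm : 2 ≤ m) {f : EuclideanSpace ℝ (Fin (m+1)) → ℝ}
    (hf : Integrable f) :
    Integrable (fun x => f x * (max ‖x‖ r) ^ (1 - (m : ℝ))) :=
  hf.mul_bdd (c := r ^ (1 - (m : ℝ))) (max_meas r _).aestronglyMeasurable
    (Eventually.of_forall (max_bound hr hm))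

lemma swap_formula {r : ℝ} (hr : 0 < r) (hm : 2 ≤ m) {f : EuclideanSpace ℝ (Fin (m+1)) → ℝ}
    (hfm : Measurable f) (hf : Integrable f) (μ : Measure (EuclideanSpace ℝ (Fin (m+1))))
    (hμ : μ (sphere 0 r) ≠ ⊤) (hinv : RotInv μ r) :
    ∫ y in sphere 0 r, (∫ x, f x * ‖x - y‖ ^ (1 - (m : ℝ))) ∂μ
      = (μ (sphere 0 r)).toReal * ∫ x, f x * (max ‖x‖ r) ^ (1 - (m : ℝ)) := by
  have hfin : IsFiniteMeasure (μ.restrict (sphere (0 : EuclideanSpace ℝ (Fin (m+1))) r)) :=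
    ⟨by simpa using hμ.lt_top⟩
  have hae : ∀ᵐ x : EuclideanSpace ℝ (Fin (m+1)), ‖x‖ ≠ r := by
    have h0 : volume (sphere (0 : EuclideanSpace ℝ (Fin (m+1))) r) = 0 :=
      Measure.addHaar_sphere _ _ _
    filter_upwards [compl_mem_ae_iff.2 h0] with x hx
    simpa using hx
  have hmeas : Measurable (fun p : EuclideanSpace ℝ (Fin (m+1)) × EuclideanSpace ℝ (Fin (m+1)) =>
      f p.1 * ‖p.1 - p.2‖ ^ (1 - (m : ℝ))) :=
    (hfm.comp measurable_fst).mul (by fun_prop)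
  have hint : Integrable (Function.uncurry fun x y : EuclideanSpace ℝ (Fin (m+1)) =>
      f x * ‖x - y‖ ^ (1 - (m : ℝ))) (volume.prod (μ.restrict (sphere 0 r))) := by
    refine (integrable_prod_iff hmeas.aestronglyMeasurable).2 ⟨?_, ?_⟩
    · filter_upwards [hae] with x hx
      apply int_on μ hμ
      refine ContinuousOn.mul continuousOn_const (ContinuousOn.rpow_const (by fun_prop) ?_)
      intro y hy
      left
      simp only [ne_eq, norm_eq_zero, sub_eq_zero]
      rintro rfl
      exact hx (by simpa using hy)
    · have h1 : Integrable (fun x => (μ (sphere 0 r)).toReal *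
          (|f x| * (max ‖x‖ r) ^ (1 - (m : ℝ)))) := (fE_max_int hr hm hf.abs).const_mul _
      refine h1.congr ?_
      filter_upwards [hae] with x hx
      have := shell hm μ hr hμ hinv x hx
      simp only [norm_mul, Real.norm_eq_abs]
      have e : ∀ y : EuclideanSpace ℝ (Fin (m+1)), |‖x - y‖ ^ (1 - (m : ℝ))| = ‖x - y‖ ^ (1 - (m : ℝ)) :=
        fun y => abs_of_nonneg (rpow_nonneg (norm_nonneg _) _)
      simp only [e]
      rw [integral_const_mul, this]
      ring
  rw [← integral_integral_swap hint, ← integral_const_mul]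
  apply integral_congr_ae
  filter_upwards [hae] with x hx
  rw [integral_const_mul, shell hm μ hr hμ hinv x hx]
  ring

lemma g_mono {r s p : ℝ} (hr : 0 < r) (hrs : r ≤ s) (hp : p ≤ 0) {t t' : ℝ} (ht : t ≤ t') :
    (max t' r) ^ p - (max t' s) ^ p ≤ (max t r) ^ p - (max t s) ^ p := by
  have h0 : ∀ u, 0 < max u r := fun u => lt_max_of_lt_right hr
  rcases le_total t' s with h | h
  · rw [max_eq_right h, max_eq_right (ht.trans h)]
    have := rpow_le_rpow_of_nonpos (h0 t) (max_le_max_right r ht) hp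
    linarith
  · rw [max_eq_left h, max_eq_left (hrs.trans h)]
    have := rpow_le_rpow_of_nonpos (h0 t) (max_le_max_left t hrs) hp
    linarith

lemma bathtub {E : Set (EuclideanSpace ℝ (Fin (m+1)))} (hE : MeasurableSet E)
    (hvol : volume E = volume (ball (0 : EuclideanSpace ℝ (Fin (m+1))) 1)) (hm : 2 ≤ m)
    {r s : ℝ} (hr : 0 < r) (hrs : r ≤ s) :
    ∫ x, fE E x * (max ‖x‖ s) ^ (1 - (m : ℝ)) ≤ ∫ x, fE E x * (max ‖x‖ r) ^ (1 - (m : ℝ)) := by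
  have hm' : (2 : ℝ) ≤ m := by exact_mod_cast hm
  have hf := fE_integrable hE hvol
  have hir := fE_max_int hr hm hf
  have his := fE_max_int (hr.trans_le hrs) hm hf
  set c := (max 1 r) ^ (1 - (m : ℝ)) - (max 1 s) ^ (1 - (m : ℝ))
  have h1 : 0 ≤ ∫ x, (fE E x * (max ‖x‖ r) ^ (1 - (m : ℝ)) - fE E x * (max ‖x‖ s) ^ (1 - (m : ℝ))
      - fE E x * c) := by
    apply integral_nonneg
    intro x
    have : fE E x * (max ‖x‖ r) ^ (1 - (m : ℝ)) - fE E x * (max ‖x‖ s) ^ (1 - (m : ℝ)) - fE E x * c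
      = fE E x * ((max ‖x‖ r) ^ (1 - (m : ℝ)) - (max ‖x‖ s) ^ (1 - (m : ℝ)) - c) := by ring
    simp only [Pi.zero_apply]
    rw [this]
    by_cases hx : x ∈ ball (0 : EuclideanSpace ℝ (Fin (m+1))) 1
    · apply mul_nonneg
      · by_cases hxE : x ∈ E <;> simp [fE, hx, hxE, -mem_ball]
      · have := g_mono hr hrs (p := 1 - (m : ℝ)) (by linarith) (t := ‖x‖) (t' := 1)
          (by simpa using (mem_ball_zero_iff.1 hx).le)
        linarith
    · apply mul_nonneg_of_nonpos_of_nonpos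
      · by_cases hxE : x ∈ E <;> simp [fE, hx, hxE, -mem_ball]
      · have := g_mono hr hrs (p := 1 - (m : ℝ)) (by linarith) (t := 1) (t' := ‖x‖)
          (by simpa using hx)
        linarith
  rw [integral_sub (f := fun x => fE E x * (max ‖x‖ r) ^ (1 - (m : ℝ)) -
    fE E x * (max ‖x‖ s) ^ (1 - (m : ℝ))) (hir.sub his) (hf.mul_const c), integral_sub hir his, integral_mul_const,
    fE_integral hE hvol] at h1
  linarith

end main

/-- The spherical averages of the Newtonian potential of `χ_{B_1} - χ_E` are
nonincreasing in the radius. -/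
theorem statement8 (n : ℕ) (hn : 3 ≤ n) (E : Set (EuclideanSpace ℝ (Fin n)))
    (hE : MeasurableSet E)
    (hvol : volume E = volume (ball (0 : EuclideanSpace ℝ (Fin n)) 1)) :
    AntitoneOn (sphAvg (newtPot E)) (Set.Ioi 0) := by
  obtain ⟨m, rfl⟩ : ∃ m, n = m + 1 := ⟨n - 1, by omega⟩
  have hm : 2 ≤ m := by omega
  have hm' : (2 : ℝ) ≤ m := by exact_mod_cast hm
  have hd : (0 : ℝ) ≤ ((m + 1 : ℕ) : ℝ) - 1 := by push_cast; linarith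
  have hexp : 2 - ((m + 1 : ℕ) : ℝ) = 1 - (m : ℝ) := by push_cast; ring
  have hsc : ∀ r : ℝ, 0 < r → ∃ k : NNReal, k ≠ 0 ∧
      μH[((m + 1 : ℕ) : ℝ) - 1] (sphere (0 : EuclideanSpace ℝ (Fin (m+1))) r)
      = k • μH[((m + 1 : ℕ) : ℝ) - 1] (sphere (0 : EuclideanSpace ℝ (Fin (m+1))) 1) := by
    intro r hr
    refine ⟨‖r‖₊ ^ (((m + 1 : ℕ) : ℝ) - 1), ?_, ?_⟩
    · exact (NNReal.rpow_pos (by simpa using hr.ne')).ne'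
    · rw [← Measure.hausdorffMeasure_smul₀ hd hr.ne', smul_sphere' hr.ne']
      simp [abs_of_pos hr]
  by_cases h0 : μH[((m + 1 : ℕ) : ℝ) - 1] (sphere (0 : EuclideanSpace ℝ (Fin (m+1))) 1) = 0 ∨
      μH[((m + 1 : ℕ) : ℝ) - 1] (sphere (0 : EuclideanSpace ℝ (Fin (m+1))) 1) = ⊤
  · have hz : ∀ r : ℝ, 0 < r → sphAvg (newtPot E) r = 0 := by
      intro r hr
      obtain ⟨k, hk, hk'⟩ := hsc r hr
      unfold sphAvg
      rw [hk']
      rcases h0 with h | h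
      · rw [h, smul_zero]; simp
      · rw [h, ENNReal.smul_top]; simp [hk]
    intro r hr s hs _
    rw [hz r hr, hz s hs]
  · push Not at h0
    have hz : ∀ r : ℝ, 0 < r → sphAvg (newtPot E) r
        = ∫ x, fE E x * (max ‖x‖ r) ^ (1 - (m : ℝ)) := by
      intro r hr
      obtain ⟨k, hk, hk'⟩ := hsc r hr
      have ht : μH[((m + 1 : ℕ) : ℝ) - 1] (sphere (0 : EuclideanSpace ℝ (Fin (m+1))) r) ≠ ⊤ := by
        rw [hk']; exact ENNReal.mul_ne_top ENNReal.coe_ne_top h0.2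
      have ht0 : μH[((m + 1 : ℕ) : ℝ) - 1] (sphere (0 : EuclideanSpace ℝ (Fin (m+1))) r) ≠ 0 := by
        rw [hk']; exact mul_ne_zero (by simpa using hk) h0.1
      unfold sphAvg newtPot
      rw [hexp, swap_formula hr hm (fE_meas hE) (fE_integrable hE hvol) _ ht
        (rotInv_hausdorff _ r), inv_mul_cancel_left₀]
      exact (ENNReal.toReal_pos ht0 ht).ne'
    intro r hr s hs hrs
    rw [hz r hr, hz s hs]
    exact bathtub hE hvol hm hr hrs
end
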